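/- arXiv:1106.3625 — 10 statements merged into one kernel-verified Lean document; each statement's English description precedes it below -/
import Mathlib

section
/- For any linear [n,k,d]_q code with information locality r (with k ≥ 1, r ≥ 1), the redundancy satisfies n − k ≥ ⌈k/r⌉ + d − 2. -/
open Matrix Finset

/-- The Hamming weight of the codeword encoding `x` under the code with points `c`. -/
def codewordWeight {n k : ℕ} {F : Type} [Field F] [DecidableEq F]
    (c : Fin n → Fin k → F) (x : Fin k → F) : ℕ :=
  (Finset.univ.filter fun i : Fin n => c i ⬝ᵥ x ≠ 0).card

/-- The code determined by the points `c` has minimum distance `d`. -/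
def HasDistance {n k : ℕ} {F : Type} [Field F] [DecidableEq F]
    (c : Fin n → Fin k → F) (d : ℕ) : Prop :=
  (∀ x : Fin k → F, x ≠ 0 → d ≤ codewordWeight c x) ∧
  (∃ x : Fin k → F, x ≠ 0 ∧ codewordWeight c x = d)

/-- `loc(c_i) ≤ r`: the point `c i` is a linear combination of at most `r` other points. -/
def LocLE {n k : ℕ} {F : Type} [Field F]
    (c : Fin n → Fin k → F) (i : Fin n) (r : ℕ) : Prop :=
  ∃ R : Finset (Fin n), i ∉ R ∧ R.card ≤ r ∧
    ∃ lam : Fin n → F, c i = ∑ j ∈ R, lam j • c j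

/-- The code has information locality `r`: some spanning subset of points has locality ≤ r. -/
def InfoLocality {n k : ℕ} {F : Type} [Field F]
    (c : Fin n → Fin k → F) (r : ℕ) : Prop :=
  ∃ I : Set (Fin n), Submodule.span F (c '' I) = ⊤ ∧ ∀ i ∈ I, LocLE c i r

section PointRank

variable {F : Type} [Field F] {n k : ℕ}

/-- The dimension of the span of the points of `c` indexed by `T`. -/
noncomputable def pointRank (c : Fin n → Fin k → F) (T : Finset (Fin n)) : ℕ :=
  Module.finrank F (Submodule.span F (c '' (T : Set (Fin n))))

lemma pointRank_le_card (c : Fin n → Fin k → F) (T : Finset (Fin n)) :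
    pointRank c T ≤ T.card := by
  classical
  have h := finrank_span_finset_le_card (R := F) (T.image c)
  rw [Set.finrank, Finset.coe_image] at h
  exact h.trans Finset.card_image_le

lemma pointRank_union_le (c : Fin n → Fin k → F) (T R : Finset (Fin n)) :
    pointRank c (T ∪ R) ≤ pointRank c T + (R \ T).card := by
  have h := Submodule.finrank_add_le_finrank_add_finrank
    (Submodule.span F (c '' (T : Set (Fin n))))
    (Submodule.span F (c '' ((R \ T : Finset (Fin n)) : Set (Fin n))))
  rw [← Submodule.span_union, ← Set.image_union, ← Finset.coe_union,
    Finset.union_sdiff_self_eq_union] at h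
  exact h.trans (Nat.add_le_add_left (pointRank_le_card c _) _)

lemma pointRank_insert_of_mem_span (c : Fin n → Fin k → F) {T : Finset (Fin n)} {i : Fin n}
    (hi : c i ∈ Submodule.span F (c '' (T : Set (Fin n)))) :
    pointRank c (insert i T) = pointRank c T := by
  rw [pointRank, pointRank, Finset.coe_insert, Set.image_insert_eq,
    Submodule.span_insert_eq_span hi]

lemma pointRank_lt_insert (c : Fin n → Fin k → F) {T : Finset (Fin n)} {i : Fin n}
    (hi : c i ∉ Submodule.span F (c '' (T : Set (Fin n)))) :
    pointRank c T < pointRank c (insert i T) := by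
  refine Submodule.finrank_lt_finrank_of_lt (lt_of_le_of_ne ?_ fun h => hi ?_)
  · exact Submodule.span_mono (Set.image_mono (by simp))
  · rw [h]
    exact Submodule.subset_span ⟨i, by simp, rfl⟩

/-- A set of points of rank less than `k` misses a point of any spanning set. -/
lemma exists_notMem_span (c : Fin n → Fin k → F) {I : Set (Fin n)}
    (hI : Submodule.span F (c '' I) = ⊤) {T : Finset (Fin n)} (hT : pointRank c T < k) :
    ∃ i ∈ I, c i ∉ Submodule.span F (c '' (T : Set (Fin n))) := by
  by_contra! h
  have htop : Submodule.span F (c '' (T : Set (Fin n))) = ⊤ := by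
    rw [eq_top_iff, ← hI, Submodule.span_le]
    rintro _ ⟨i, hi, rfl⟩
    exact h i hi
  rw [pointRank, htop, finrank_top, Module.finrank_fin_fun] at hT
  exact lt_irrefl _ hT

/-- Adjoining repair groups one at a time gives sets of small rank and large cardinality. -/
lemma exists_pointRank_add_le_card {r : ℕ} (c : Fin n → Fin k → F)
    (hloc : InfoLocality c r) (t : ℕ) (ht : t * r < k) :
    ∃ T : Finset (Fin n), pointRank c T ≤ t * r ∧ pointRank c T + t ≤ T.card := by
  obtain ⟨I, hI, hIloc⟩ := hloc
  induction t with
  | zero => exact ⟨∅, by simp [pointRank]⟩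
  | succ t ih =>
    rw [Nat.succ_mul] at ht ⊢
    obtain ⟨T, hTr, hTc⟩ := ih (by omega)
    obtain ⟨i, hiI, hi⟩ := exists_notMem_span c hI (T := T) (by omega)
    obtain ⟨R, hiR, hRr, lam, hlam⟩ := hIloc i hiI
    have hiT : i ∉ T := fun h => hi (Submodule.subset_span ⟨i, h, rfl⟩)
    have hmem : c i ∈ Submodule.span F (c '' ((T ∪ R : Finset (Fin n)) : Set (Fin n))) := by
      rw [hlam]
      exact Submodule.sum_mem _ fun j hj => Submodule.smul_mem _ _
        (Submodule.subset_span ⟨j, by simp [hj], rfl⟩)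
    have hrank := pointRank_union_le c T R
    have hcard : (insert i (T ∪ R)).card = T.card + (R \ T).card + 1 := by
      rw [Finset.card_insert_of_notMem (by simp [hiT, hiR]), ← Finset.union_sdiff_self_eq_union,
        Finset.card_union_of_disjoint Finset.disjoint_sdiff]
    have hsd : (R \ T).card ≤ R.card := Finset.card_le_card Finset.sdiff_subset
    refine ⟨insert i (T ∪ R), ?_, ?_⟩ <;> rw [pointRank_insert_of_mem_span c hmem] <;> omega

/-- A set of points of rank less than `k` extends to one of rank exactly `k - 1`, without
decreasing the excess of cardinality over rank. -/
lemma exists_pointRank_add_one_eq (c : Fin n → Fin k → F)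
    (hspan : Submodule.span F (Set.range c) = ⊤) {t : ℕ} (T : Finset (Fin n))
    (hT : pointRank c T < k) (htT : pointRank c T + t ≤ T.card) :
    ∃ S : Finset (Fin n), pointRank c S + 1 = k ∧ pointRank c S + t ≤ S.card := by
  induction hm : k - pointRank c T using Nat.strong_induction_on generalizing T with
  | _ m ih =>
    by_cases hk : pointRank c T + 1 = k
    · exact ⟨T, hk, htT⟩
    obtain ⟨i, -, hi⟩ := exists_notMem_span c (I := Set.univ) (by rwa [Set.image_univ]) hT
    have hiT : i ∉ T := fun h => hi (Submodule.subset_span ⟨i, h, rfl⟩)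
    have hlt := pointRank_lt_insert c hi
    have hle : pointRank c (insert i T) ≤ pointRank c T + 1 := by
      have h := pointRank_union_le c T {i}
      rw [Finset.union_comm, ← Finset.insert_eq] at h
      exact h.trans (Nat.add_le_add_left
        ((Finset.card_le_card Finset.sdiff_subset).trans_eq (Finset.card_singleton i)) _)
    have hcard := Finset.card_insert_of_notMem hiT
    exact ih _ (by omega) (insert i T) (by omega) (by omega) rfl

/-- A set of points of rank less than `k` lies in a hyperplane, so its complement has at least
as many points as the minimum distance. -/
lemma card_add_le_of_pointRank_lt [DecidableEq F] {d : ℕ} (c : Fin n → Fin k → F)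
    (hd : ∀ x : Fin k → F, x ≠ 0 → d ≤ codewordWeight c x) {S : Finset (Fin n)}
    (hS : pointRank c S < k) : S.card + d ≤ n := by
  have hlt : Submodule.span F (c '' (S : Set (Fin n))) < ⊤ := by
    refine lt_top_iff_ne_top.2 fun h => ?_
    rw [pointRank, h, finrank_top, Module.finrank_fin_fun] at hS
    exact lt_irrefl _ hS
  obtain ⟨f, hf, hker⟩ := Submodule.exists_le_ker_of_lt_top _ hlt
  let x : Fin k → F := fun i => f fun j => if i = j then 1 else 0
  have hfx : ∀ v, f v = v ⬝ᵥ x := fun v => by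
    rw [LinearMap.pi_apply_eq_sum_univ f v]
    rfl
  have hx : x ≠ 0 := fun h => hf (LinearMap.ext fun v => by simp [hfx, h])
  have hsub : (Finset.univ.filter fun i : Fin n => c i ⬝ᵥ x ≠ 0) ⊆ Sᶜ := by
    intro i hi
    rw [Finset.mem_compl]
    intro hiS
    refine (Finset.mem_filter.1 hi).2 ?_
    rw [← hfx]
    exact hker (Submodule.subset_span ⟨i, hiS, rfl⟩)
  have hw := (hd x hx).trans (Finset.card_le_card hsub)
  have hc := Finset.card_add_card_compl S
  rw [Fintype.card_fin] at hc
  omega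

end PointRank

/-- For any linear [n,k,d]_q code with information locality r (k ≥ 1, r ≥ 1),
    n − k ≥ ⌈k/r⌉ + d − 2. -/
theorem redundancy_lower_bound
    {F : Type} [Field F] [Fintype F] [DecidableEq F]
    {n k d r : ℕ} (hk : 1 ≤ k) (hr : 1 ≤ r)
    (c : Fin n → Fin k → F)
    (hspan : Submodule.span F (Set.range c) = ⊤)
    (hdist : HasDistance c d)
    (hloc : InfoLocality c r) :
    ⌈(k : ℚ) / r⌉ + d - 2 ≤ (n : ℤ) - k := by
  have hr' : (0 : ℚ) < r := by exact_mod_cast hr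
  have hdiv : ((k - 1) / r : ℕ) * r < k := by
    have := Nat.div_mul_le_self (k - 1) r
    omega
  obtain ⟨T, hTr, hTc⟩ := exists_pointRank_add_le_card c hloc ((k - 1) / r) hdiv
  obtain ⟨S, hSk, hSc⟩ := exists_pointRank_add_one_eq c hspan T (hTr.trans_lt hdiv) hTc
  have hn := card_add_le_of_pointRank_lt c hdist.1 (S := S) (by omega)
  have hceil : ⌈(k : ℚ) / r⌉ ≤ (((k - 1) / r : ℕ) : ℤ) + 1 := by
    rw [Int.ceil_le, div_le_iff₀ hr']
    have h := Nat.lt_mul_div_succ (k - 1) hr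
    have h' : k ≤ ((k - 1) / r + 1) * r := by
      rw [mul_comm]
      omega
    exact_mod_cast h'
  omega
end

section
/- Let C be a systematic linear [n,k,d]_q code with information locality r, where d < r + 3, r < k, r | k, and n = k + k/r + d − 2 (so that C is canonical with point set I ∪ C′ ∪ C″). Then every point c′ ∈ C′ has locality exactly r, and every point c″ ∈ C″ has locality at least k − (k/r − 1)(d − 3). -/
open Matrix Finset

/-- The code is systematic: the k standard basis vectors are among the points. -/
def Systematic {n k : ℕ} {F : Type} [Field F]
    (c : Fin n → Fin k → F) : Prop :=
  ∀ j : Fin k, ∃ i : Fin n, c i = Pi.single j 1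

/-- The support of a point, as a finset. -/
def fsupp {k : ℕ} {F : Type} [Field F] [DecidableEq F] (v : Fin k → F) : Finset (Fin k) :=
  Finset.univ.filter fun j => v j ≠ 0

/-- Fewer than `k` points of `F ^ k` have a common nonzero orthogonal vector. -/
lemma exists_ne_zero_forall_dotProduct_eq_zero {n k : ℕ} {F : Type} [Field F]
    (c : Fin n → Fin k → F) (U : Finset (Fin n)) (hU : U.card < k) :
    ∃ x : Fin k → F, x ≠ 0 ∧ ∀ i ∈ U, c i ⬝ᵥ x = 0 := by
  let f : (Fin k → F) →ₗ[F] (U → F) := (Matrix.of fun u : U => c u).mulVecLin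
  have hf : LinearMap.ker f ≠ ⊥ := LinearMap.ker_ne_bot_of_finrank_lt (by simpa using hU)
  obtain ⟨x, hx, hx0⟩ := (Submodule.ne_bot_iff _).1 hf
  exact ⟨x, hx0, fun i hi => congrFun (LinearMap.mem_ker.1 hx) ⟨i, hi⟩⟩

/-- If the points of `D ⊆ T` are redundant in `T` (every vector orthogonal to `T \ D` is
orthogonal to `D`) and `D` is large enough relative to the distance, then `T` has at least
`D.card + k` points. -/
lemma card_add_le_card_of_redundant {n k d : ℕ} {F : Type} [Field F] [DecidableEq F]
    {c : Fin n → Fin k → F}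
    (hdist : ∀ x : Fin k → F, x ≠ 0 → d ≤ codewordWeight c x)
    {D T : Finset (Fin n)} (hDT : D ⊆ T) (hDn : D.card + k ≤ n + 1)
    (hDd : n + 1 < D.card + k + d)
    (hred : ∀ x : Fin k → F, (∀ i ∈ T \ D, c i ⬝ᵥ x = 0) → ∀ i ∈ D, c i ⬝ᵥ x = 0) :
    D.card + k ≤ T.card := by
  by_contra! hlt
  have hTD : (T \ D).card = T.card - D.card := Finset.card_sdiff_of_subset hDT
  have hDc : Dᶜ.card = n - D.card := by simp [Finset.card_compl]
  have hle := Finset.card_le_card hDT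
  obtain ⟨U, hTU, hUD, hU⟩ := Finset.exists_subsuperset_card_eq (n := k - 1)
    (show T \ D ⊆ Dᶜ by intro i; simp) (by omega) (by omega)
  obtain ⟨x, hx0, hx⟩ := exists_ne_zero_forall_dotProduct_eq_zero c U (by omega)
  have hxD := hred x fun i hi => hx i (hTU hi)
  have hdisj : Disjoint U D := Finset.disjoint_left.2 fun i hi => by simpa using hUD hi
  have hsub : (Finset.univ.filter fun i : Fin n => c i ⬝ᵥ x ≠ 0) ⊆ (U ∪ D)ᶜ := by
    intro i hi
    simp only [Finset.mem_filter, Finset.mem_univ, true_and] at hi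
    simp only [Finset.mem_compl, Finset.mem_union]
    rintro (h | h)
    exacts [hi (hx i h), hi (hxD i h)]
  have hw : codewordWeight c x ≤ (U ∪ D)ᶜ.card := Finset.card_le_card hsub
  rw [Finset.card_compl, Finset.card_union_of_disjoint hdisj, Fintype.card_fin] at hw
  have := hdist x hx0
  omega

/-- The positions of a point `b` and of the unit vectors `e j` with `j` in the support of `b`. -/
def parityBlock {n k : ℕ} {F : Type} [Field F] [DecidableEq F]
    (c : Fin n → Fin k → F) (e : Fin k → Fin n) (b : Fin n) : Finset (Fin n) :=
  insert b ((fsupp (c b)).image e)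

lemma card_parityBlock_le {n k : ℕ} {F : Type} [Field F] [DecidableEq F]
    (c : Fin n → Fin k → F) (e : Fin k → Fin n) (b : Fin n) :
    (parityBlock c e b).card ≤ (fsupp (c b)).card + 1 :=
  (Finset.card_insert_le _ _).trans (Nat.add_le_add_right Finset.card_image_le 1)

/-- A point is recovered from the unit vectors on its support. -/
lemma locLE_card_fsupp {n k : ℕ} {F : Type} [Field F] [DecidableEq F]
    {c : Fin n → Fin k → F} {e : Fin k → Fin n} (he : ∀ j, c (e j) = Pi.single j 1)
    (hinj : Function.Injective e) {i : Fin n} (hi : ∀ j, e j ≠ i) :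
    LocLE c i (fsupp (c i)).card := by
  refine ⟨(fsupp (c i)).image e, by simp [hi], Finset.card_image_le,
    Function.extend e (c i) 0, ?_⟩
  rw [Finset.sum_image fun _ _ _ _ h => hinj h]
  simp only [hinj.extend_apply, he]
  ext j
  simp [Finset.sum_apply, Pi.single_apply, fsupp]

/-- A vector orthogonal to the unit vectors on the support of `v` is orthogonal to `v`. -/
lemma dotProduct_eq_zero_of_fsupp {k : ℕ} {F : Type} [Field F] [DecidableEq F]
    {v x : Fin k → F} (h : ∀ j ∈ fsupp v, x j = 0) : v ⬝ᵥ x = 0 := by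
  refine Finset.sum_eq_zero fun j _ => ?_
  by_cases hj : v j = 0
  · simp [hj]
  · simp [h j (by simpa [fsupp] using hj)]

/-- A relation expressing a parity point `i` through points of `R`, joined with all parity blocks
except that of `b₀`, involves at least `C.card + k` points. -/
lemma card_add_le_card_union_parityBlocks {n k d : ℕ} {F : Type} [Field F] [DecidableEq F]
    {c : Fin n → Fin k → F}
    (hdist : ∀ x : Fin k → F, x ≠ 0 → d ≤ codewordWeight c x)
    {e : Fin k → Fin n} (he : ∀ j, c (e j) = Pi.single j 1)
    {C : Finset (Fin n)} (heC : ∀ j, e j ∉ C)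
    (hCn : C.card + k ≤ n + 1) (hCd : n + 1 < C.card + k + d)
    {i b₀ : Fin n} (hie : ∀ j, e j ≠ i) (hb₀ : b₀ ∈ C) (hiC : i ∉ C.erase b₀)
    {R : Finset (Fin n)} (hiR : i ∉ R) {lam : Fin n → F} (hlam : c i = ∑ j ∈ R, lam j • c j) :
    C.card + k ≤ (insert i R ∪ (C.erase b₀).biUnion (parityBlock c e)).card := by
  have hD : (insert i (C.erase b₀)).card = C.card := by
    rw [Finset.card_insert_of_notMem hiC, Finset.card_erase_add_one hb₀]
  rw [← hD] at hCn hCd ⊢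
  refine card_add_le_card_of_redundant hdist ?_ hCn hCd ?_
  · intro t ht
    rcases Finset.mem_insert.1 ht with rfl | ht
    · simp
    · exact Finset.mem_union_right _ (Finset.mem_biUnion.2 ⟨t, ht, by simp [parityBlock]⟩)
  · intro x hx
    have hC : ∀ b ∈ C.erase b₀, c b ⬝ᵥ x = 0 := by
      intro b hb
      refine dotProduct_eq_zero_of_fsupp fun j hj => ?_
      have := hx (e j) (Finset.mem_sdiff.2 ⟨Finset.mem_union_right _ (Finset.mem_biUnion.2
        ⟨b, hb, Finset.mem_insert_of_mem (Finset.mem_image_of_mem e hj)⟩),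
        by simp [hie, heC]⟩)
      simpa [he] using this
    intro t ht
    rcases Finset.mem_insert.1 ht with rfl | ht
    · rw [hlam, sum_dotProduct]
      refine Finset.sum_eq_zero fun j hj => ?_
      rw [smul_dotProduct]
      by_cases hjC : j ∈ C.erase b₀
      · rw [hC j hjC, smul_zero]
      · have hjt : j ≠ t := fun h => hiR (h ▸ hj)
        rw [hx j (Finset.mem_sdiff.2 ⟨by simp [hj], by simp [hjt, hjC]⟩), smul_zero]
    · exact hC t ht

/-- Parity locality lower bound for optimal codes with d < r + 3, r < k, r ∣ k and
    n = k + k/r + d − 2 (which are canonical, with canonical partition I ∪ C₁ ∪ C₂):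
    each point of C₁ has locality exactly r, and each point of C₂ has locality at least
    k − (k/r − 1)(d − 3). -/
theorem parity_locality_lower_bound
    {F : Type} [Field F] [Fintype F] [DecidableEq F]
    {n k d r : ℕ} (hdr : d < r + 3) (hrlt : r < k) (hrk : r ∣ k)
    (hn : (n : ℤ) = k + k / r + d - 2)
    (c : Fin n → Fin k → F)
    (hsys : Systematic c)
    (hspan : Submodule.span F (Set.range c) = ⊤)
    (hdist : HasDistance c d)
    (hloc : InfoLocality c r)
    -- the canonical partition of the point set
    (I C₁ C₂ : Finset (Fin n))
    (hIC₁ : Disjoint I C₁) (hIC₂ : Disjoint I C₂) (hC₁C₂ : Disjoint C₁ C₂)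
    (hcover : I ∪ C₁ ∪ C₂ = Finset.univ)
    (hI : I.card = k)
    (hIbasis : ∀ i ∈ I, ∃ j : Fin k, c i = Pi.single j 1)
    (hIbasis' : ∀ j : Fin k, ∃ i ∈ I, c i = Pi.single j 1)
    (hC₁card : C₁.card = k / r)
    (hC₁wt : ∀ i ∈ C₁, (fsupp (c i)).card = r)
    (hC₁disj : ∀ i ∈ C₁, ∀ i' ∈ C₁, i ≠ i' → Disjoint (fsupp (c i)) (fsupp (c i')))
    (hC₁cover : (C₁.biUnion fun i => fsupp (c i)) = Finset.univ)
    (hC₂card : C₂.card = d - 2)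
    (hC₂wt : ∀ i ∈ C₂, (fsupp (c i)).card = k) :
    (∀ i ∈ C₁, LocLE c i r ∧ ∀ m : ℕ, LocLE c i m → r ≤ m) ∧
    (∀ i ∈ C₂, ∀ m : ℕ, LocLE c i m → (k : ℤ) - ((k : ℤ) / r - 1) * ((d : ℤ) - 3) ≤ m) := by
  have hr : 0 < r := Nat.pos_of_dvd_of_pos hrk (by omega)
  obtain ⟨q, rfl⟩ := hrk
  have hq : r * q / r = q := Nat.mul_div_cancel_left q hr
  have hqZ : ((r * q : ℕ) : ℤ) / r = q := by exact_mod_cast hq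
  rw [hqZ] at hn ⊢
  rw [hq] at hC₁card
  choose e heI he using hIbasis'
  have hinj : Function.Injective e := by
    intro j j' h
    have h1 := congrFun (he j) j
    rw [h, he j'] at h1
    by_contra hne
    simp [hne] at h1
  have heC₁ : ∀ j, e j ∉ C₁ := fun j => Finset.disjoint_left.1 hIC₁ (heI j)
  have heC₂ : ∀ j, e j ∉ C₂ := fun j => Finset.disjoint_left.1 hIC₂ (heI j)
  have he_ne : ∀ i, i ∉ I → ∀ j, e j ≠ i := by
    rintro i hi j rfl
    exact hi (heI j)
  have heI' : Finset.univ.image e = I :=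
    Finset.eq_of_subset_of_card_le (by intro t; simp only [Finset.mem_image]; grind)
      (by rw [Finset.card_image_of_injective _ hinj, hI]; simp)
  have hcard : r * q + q + (d - 2) = n := by
    have := congrArg Finset.card hcover
    rw [Finset.card_union_of_disjoint (Finset.disjoint_union_left.2 ⟨hIC₂, hC₁C₂⟩),
      Finset.card_union_of_disjoint hIC₁] at this
    simpa [hI, hC₁card, hC₂card] using this
  have hd : 2 ≤ d := by
    zify at hcard
    push_cast at hn
    omega
  have hcov : ∀ t, (∃ b ∈ C₁, t ∈ parityBlock c e b) ∨ t ∈ C₂ := by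
    intro t
    have ht : t ∈ I ∪ C₁ ∪ C₂ := hcover ▸ Finset.mem_univ t
    rcases Finset.mem_union.1 ht with ht | ht
    · left
      rcases Finset.mem_union.1 ht with ht | ht
      · rw [← heI'] at ht
        obtain ⟨j, -, rfl⟩ := Finset.mem_image.1 ht
        obtain ⟨b, hb, hj⟩ := Finset.mem_biUnion.1 (hC₁cover ▸ Finset.mem_univ j)
        exact ⟨b, hb, Finset.mem_insert_of_mem (Finset.mem_image_of_mem e hj)⟩
      · exact ⟨t, ht, Finset.mem_insert_self _ _⟩
    · exact Or.inr ht
  have hblockC₂ : ∀ b ∈ C₁, Disjoint (parityBlock c e b) C₂ := by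
    intro b hb
    rw [parityBlock, Finset.disjoint_insert_left]
    refine ⟨Finset.disjoint_left.1 hC₁C₂ hb, Finset.disjoint_left.2 fun t ht => ?_⟩
    obtain ⟨j, -, rfl⟩ := Finset.mem_image.1 ht
    exact heC₂ j
  have hblock : ∀ b ∈ C₁, ∀ b' ∈ C₁, b ≠ b' →
      Disjoint (parityBlock c e b) (parityBlock c e b') := by
    intro b hb b' hb' hne
    have himg : ∀ b ∈ C₁, ∀ s : Finset (Fin (r * q)), b ∉ s.image e := by
      intro b hb s h
      obtain ⟨j, -, rfl⟩ := Finset.mem_image.1 h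
      exact heC₁ j hb
    rw [parityBlock, parityBlock, Finset.disjoint_insert_left, Finset.disjoint_insert_right,
      Finset.mem_insert, Finset.disjoint_image hinj]
    exact ⟨by simp only [not_or]; exact ⟨hne, himg b hb _⟩, himg b' hb' _,
      hC₁disj b hb b' hb' hne⟩
  have key : ∀ i b₀ : Fin n, i ∉ I → b₀ ∈ C₁ → i ∉ C₁.erase b₀ → ∀ R : Finset (Fin n), i ∉ R →
      ∀ lam : Fin n → F, c i = ∑ j ∈ R, lam j • c j →
      r + 1 ≤ (insert i R ∩ parityBlock c e b₀).card + (insert i R ∩ C₂).card := by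
    intro i b₀ hiI hb₀ hiC R hiR lam hlam
    have hlow := card_add_le_card_union_parityBlocks hdist.1 he heC₁ (by omega) (by omega)
      (he_ne i hiI) hb₀ hiC hiR hlam
    have hsub : insert i R ∪ (C₁.erase b₀).biUnion (parityBlock c e) ⊆
        (C₁.erase b₀).biUnion (parityBlock c e) ∪
          (insert i R ∩ parityBlock c e b₀ ∪ insert i R ∩ C₂) := by
      intro t ht
      have := hcov t
      simp only [Finset.mem_union, Finset.mem_inter, Finset.mem_biUnion, Finset.mem_erase] at ht ⊢
      grind
    have hup := (Finset.card_le_card hsub).trans ((Finset.card_union_le _ _).trans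
      (Nat.add_le_add (Finset.card_biUnion_le_card_mul _ _ (r + 1) fun b hb => by
        have := card_parityBlock_le c e b
        rwa [hC₁wt b (Finset.mem_of_mem_erase hb)] at this) (Finset.card_union_le _ _)))
    rw [Finset.card_erase_of_mem hb₀, hC₁card] at hup
    rw [hC₁card] at hlow
    have hq0 : 0 < q := hC₁card ▸ Finset.card_pos.2 ⟨b₀, hb₀⟩
    obtain ⟨p, rfl⟩ : ∃ p, q = p + 1 := ⟨q - 1, by omega⟩
    rw [Nat.add_sub_cancel] at hup
    nlinarith
  constructor
  · intro i hi
    have hiI : i ∉ I := Finset.disjoint_right.1 hIC₁ hi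
    have hle := locLE_card_fsupp he hinj (he_ne i hiI)
    rw [hC₁wt i hi] at hle
    refine ⟨hle, ?_⟩
    rintro m ⟨R, hiR, hRm, lam, hlam⟩
    have h1 := key i i hiI hi (by simp) R hiR lam hlam
    have h2 : (insert i R ∩ parityBlock c e i).card + (insert i R ∩ C₂).card ≤
        (insert i R).card := by
      rw [← Finset.card_union_of_disjoint
        ((hblockC₂ i hi).mono Finset.inter_subset_right Finset.inter_subset_right)]
      exact Finset.card_le_card
        (Finset.union_subset Finset.inter_subset_left Finset.inter_subset_left)
    rw [Finset.card_insert_of_notMem hiR] at h2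
    omega
  · rintro i hi m ⟨R, hiR, hRm, lam, hlam⟩
    have hiI : i ∉ I := Finset.disjoint_right.1 hIC₂ hi
    have hiC₁ : i ∉ C₁ := Finset.disjoint_right.1 hC₁C₂ hi
    have h1 : C₁.card * (r + 1) ≤
        ∑ b ∈ C₁, ((insert i R ∩ parityBlock c e b).card + (insert i R ∩ C₂).card) := by
      rw [← smul_eq_mul]
      exact Finset.card_nsmul_le_sum _ _ _ fun b hb =>
        key i b hiI hb (fun h => hiC₁ (Finset.mem_of_mem_erase h)) R hiR lam hlam
    have h2 : ∑ b ∈ C₁, (insert i R ∩ parityBlock c e b).card + (insert i R ∩ C₂).card ≤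
        (insert i R).card := by
      rw [← Finset.card_biUnion fun b hb b' hb' hne => (hblock b hb b' hb' hne).mono
          Finset.inter_subset_right Finset.inter_subset_right,
        ← Finset.card_union_of_disjoint ((Finset.disjoint_biUnion_left _ _ _).2 fun b hb =>
          (hblockC₂ b hb).mono Finset.inter_subset_right Finset.inter_subset_right)]
      exact Finset.card_le_card (Finset.union_subset
        (Finset.biUnion_subset.2 fun b _ => Finset.inter_subset_left) Finset.inter_subset_left)
    have h3 : (insert i R ∩ C₂).card ≤ d - 2 :=
      hC₂card ▸ Finset.card_le_card Finset.inter_subset_right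
    rw [Finset.sum_add_distrib, Finset.sum_const, smul_eq_mul, hC₁card] at h1
    rw [Finset.card_insert_of_notMem hiR] at h2
    have hq0 : 0 < q := Nat.pos_of_mul_pos_left (by omega : 0 < r * q)
    obtain ⟨p, rfl⟩ : ∃ p, q = p + 1 := ⟨q - 1, by omega⟩
    obtain ⟨s, rfl⟩ : ∃ s, d = s + 2 := ⟨d - 2, by omega⟩
    rw [Nat.add_sub_cancel] at h3
    have h4 := Nat.mul_le_mul_left p h3
    zify at h1 h2 h4 hRm
    push_cast
    linarith
end

section
/- Let L ⊆ F_q^n be a linear subspace and k a positive integer. If q > k·n^k, then there exist vectors c_1,...,c_n ∈ F_q^k that are in general position subject to L. -/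
open Finset

/-- `S` is a `k`-core for the subspace `L ⊆ F^n`: no nonzero vector of `L` has its
    support inside `S` (and `|S| = k`). -/
def IsKCore {n : ℕ} {F : Type} [Field F]
    (L : Submodule F (Fin n → F)) (k : ℕ) (S : Finset (Fin n)) : Prop :=
  S.card = k ∧ ∀ v ∈ L, v ≠ 0 → ∃ i, v i ≠ 0 ∧ i ∉ S

/-- Vectors `c_1, ..., c_n ∈ F^k` are in general position subject to `L ⊆ F^n`:
    every vector of `L` gives a linear relation among them, and the vectors indexed by
    any `k`-core of `L` span `F^k`. -/
def GeneralPositionSubjectTo {n k : ℕ} {F : Type} [Field F]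
    (L : Submodule F (Fin n → F)) (c : Fin n → Fin k → F) : Prop :=
  (∀ v ∈ L, ∑ i, v i • c i = 0) ∧
  (∀ S : Finset (Fin n), IsKCore L k S → Submodule.span F (c '' ↑S) = ⊤)

open scoped Pointwise in
/-- A finite family of proper subspaces with fewer members than the field has elements does not
cover the whole space. -/
theorem exists_forall_notMem_of_card_lt {F V ι : Type*} [Field F] [Finite F]
    [AddCommGroup V] [Module F V] (s : Finset ι) (p : ι → Submodule F V)
    (hs : s.card < Nat.card F) (hp : ∀ i ∈ s, p i ≠ ⊤) :
    ∃ v : V, ∀ i ∈ s, v ∉ p i := by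
  by_contra! h
  have hcovers : ⋃ i ∈ s, (0 : V) +ᵥ ((p i).toAddSubgroup : Set V) = Set.univ := by
    simpa [Set.eq_univ_iff_forall] using! h
  obtain ⟨i, hi, hfin, hindex⟩ := AddSubgroup.exists_index_le_card_of_leftCoset_cover hcovers
  have : Finite (V ⧸ p i) := @AddSubgroup.finite_quotient_of_finiteIndex _ _ _ hfin
  have : Nontrivial (V ⧸ p i) := Submodule.Quotient.nontrivial_iff.mpr (hp i hi)
  obtain ⟨x, hx⟩ := exists_ne (0 : V ⧸ p i)
  have hcard : Nat.card F ≤ Nat.card (V ⧸ p i) :=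
    Nat.card_le_card_of_injective (fun a : F => a • x) (smul_left_injective F hx)
  exact absurd (hcard.trans hindex) hs.not_ge

/-- Over a field with more than `s.card` elements, subspaces `U i` (`i ∈ s`) of a common dimension
that are all disjoint from `L` have a common complement containing `L`. -/
theorem Submodule.exists_common_isCompl {F V ι : Type*} [Field F] [Finite F]
    [AddCommGroup V] [Module F V] [FiniteDimensional F V] (s : Finset ι) (U : ι → Submodule F V)
    (L : Submodule F V) {k : ℕ} (hs : s.card < Nat.card F)
    (hU : ∀ i ∈ s, Module.finrank F (U i) = k) (hL : ∀ i ∈ s, Disjoint (U i) L) :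
    ∃ C : Submodule F V, L ≤ C ∧ ∀ i ∈ s, IsCompl (U i) C := by
  obtain ⟨C, ⟨hLC, hC⟩, hmax⟩ := WellFounded.has_min
    (wellFounded_gt (α := Submodule F V)) {C | L ≤ C ∧ ∀ i ∈ s, Disjoint (U i) C}
    ⟨L, le_rfl, hL⟩
  have hdim : ∀ i ∈ s, Module.finrank F ↥(U i ⊔ C) = k + Module.finrank F C := by
    intro i hi
    have := Submodule.finrank_sup_add_finrank_inf_eq (U i) C
    rwa [(hC i hi).eq_bot, finrank_bot, add_zero, hU i hi] at this
  refine ⟨C, hLC, fun i hi => ⟨hC i hi, codisjoint_iff.mpr ?_⟩⟩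
  by_contra hne
  have hproper : ∀ j ∈ s, U j ⊔ C ≠ ⊤ := by
    intro j hj htop
    apply hne
    apply Submodule.eq_top_of_finrank_eq
    rw [hdim i hi, ← hdim j hj, htop, finrank_top]
  obtain ⟨w, hw⟩ := exists_forall_notMem_of_card_lt s (fun j => U j ⊔ C) hs hproper
  refine hmax (C ⊔ F ∙ w) ⟨hLC.trans le_sup_left, fun j hj => ?_⟩ ?_
  · exact (hC j hj).disjoint_sup_right_of_disjoint_sup_left
      (Submodule.disjoint_span_singleton_of_notMem (hw j hj))
  · refine lt_of_le_of_ne le_sup_left fun heq => hw i hi ?_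
    have : w ∈ C ⊔ F ∙ w := Submodule.mem_sup_right (Submodule.mem_span_singleton_self w)
    exact Submodule.mem_sup_right (heq ▸ this)

/-- The coordinate subspace of a `k`-core is disjoint from the subspace. -/
theorem IsKCore.disjoint_span {n k : ℕ} {F : Type} [Field F] {L : Submodule F (Fin n → F)}
    {S : Finset (Fin n)} (hS : IsKCore L k S) :
    Disjoint (Submodule.span F (Pi.basisFun F (Fin n) '' ↑S)) L := by
  rw [Submodule.disjoint_def]
  intro v hvS hvL
  by_contra hv
  obtain ⟨i, hi, hiS⟩ := hS.2 v hvL hv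
  rw [Module.Basis.mem_span_image] at hvS
  exact hiS (hvS (by simpa using hi))

/-- If q > k·n^k, then vectors in general position subject to any subspace L exist. -/
theorem general_position_exists
    {F : Type} [Field F] [Fintype F]
    {n k : ℕ} (hk : 0 < k)
    (L : Submodule F (Fin n → F))
    (hq : k * n ^ k < Fintype.card F) :
    ∃ c : Fin n → Fin k → F, GeneralPositionSubjectTo L c := by
  classical
  let e := Pi.basisFun F (Fin n)
  let s : Finset (Finset (Fin n)) := {S | IsKCore L k S}
  have hcore : ∀ {S}, S ∈ s ↔ IsKCore L k S := by simp [s]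
  rcases s.eq_empty_or_nonempty with hs | ⟨S₀, hS₀⟩
  · refine ⟨0, by simp, fun S hS => ?_⟩
    exact absurd (hcore.mpr hS) (by simp [hs])
  have hcard : s.card < Nat.card F := by
    have hsub : s ⊆ Finset.univ.powersetCard k := fun S hS => by
      simpa [Finset.mem_powersetCard] using (hcore.mp hS).1
    calc s.card ≤ n.choose k := by simpa using Finset.card_le_card hsub
      _ ≤ n ^ k := Nat.choose_le_pow n k
      _ ≤ k * n ^ k := Nat.le_mul_of_pos_left _ hk
      _ < Nat.card F := by rwa [Nat.card_eq_fintype_card]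
  have hfinrank : ∀ S ∈ s, Module.finrank F (Submodule.span F (e '' ↑S)) = k := by
    intro S hS
    rw [← Finset.coe_image, finrank_span_finset_eq_card,
      Finset.card_image_of_injective _ e.injective, (hcore.mp hS).1]
    rw [Finset.coe_image]
    exact (e.linearIndependent.linearIndepOn_id.mono (Set.image_subset_range _ _))
  obtain ⟨C, hLC, hC⟩ := Submodule.exists_common_isCompl s
    (fun S => Submodule.span F (e '' ↑S)) L hcard hfinrank
    fun S hS => (hcore.mp hS).disjoint_span
  have hquot : Module.finrank F ((Fin n → F) ⧸ C) = Module.finrank F (Fin k → F) := by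
    rw [← (Submodule.quotientEquivOfIsCompl C _ (hC S₀ hS₀).symm).symm.finrank_eq,
      hfinrank S₀ hS₀, Module.finrank_fin_fun]
  let ψ := LinearEquiv.ofFinrankEq _ _ hquot
  let φ : (Fin n → F) →ₗ[F] Fin k → F := ψ.toLinearMap ∘ₗ C.mkQ
  have hker : LinearMap.ker φ = C := by simp [φ]
  have hrange : LinearMap.range φ = ⊤ := by
    simp [φ, LinearMap.range_comp]
  refine ⟨fun i => φ (e i), fun v hv => ?_, fun S hS => ?_⟩
  · have hsum : ∑ i, v i • e i = v := e.sum_repr v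
    have : φ v = 0 := LinearMap.mem_ker.mp (hker ▸ hLC hv)
    rw [← this]
    conv_rhs => rw [← hsum, map_sum]
    simp only [map_smul]
  · rw [← Set.image_image φ e, ← Submodule.map_span, ← hrange, LinearMap.range_eq_map,
      ← (hC S (hcore.mpr hS)).sup_eq_top, Submodule.map_sup, ← hker]
    rw [LinearMap.le_ker_iff_map.mp le_rfl, sup_bot_eq]
end

section
/- Let 2 < d < r + 3, r < k, r | k, let q > k·n^k be a prime power, and let n = k + k/r + d − 2. Then there exists a systematic linear [n,k,d]_q code with information locality r in which k/r of the n − k parity points have locality at most r and the remaining d − 2 parity points have locality at most k − (k/r − 1)(d − 3). -/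
open Matrix Finset

namespace LocalParityCode

/-- Finitely many nonzero polynomials of small degree have a common point of non-vanishing. -/
lemma exists_eval_ne_zero_of_card_mul_lt {F σ T : Type*} [Field F] [Fintype F] [Finite σ]
    (s : Finset T) (f : T → MvPolynomial σ F) (D : ℕ) (hf : ∀ t ∈ s, f t ≠ 0)
    (hdeg : ∀ t ∈ s, (f t).totalDegree ≤ D) (hcard : s.card * D < Fintype.card F) :
    ∃ θ : σ → F, ∀ t ∈ s, MvPolynomial.eval θ (f t) ≠ 0 := by
  classical
  by_contra! h
  have hprod : ∏ t ∈ s, f t ≠ 0 := Finset.prod_ne_zero_iff.2 hf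
  refine hprod (MvPolynomial.eq_zero_of_eval_zero_at_prod_finset _ (fun _ => Finset.univ) ?_ ?_)
  · intro i
    refine lt_of_le_of_lt (MvPolynomial.degreeOf_le_totalDegree _ _) ?_
    refine lt_of_le_of_lt (MvPolynomial.totalDegree_finsetProd _ _) ?_
    refine lt_of_le_of_lt (Finset.sum_le_card_nsmul _ _ _ hdeg) ?_
    simpa using hcard
  · intro θ _
    obtain ⟨t, ht, h0⟩ := h θ
    rw [map_prod]
    exact Finset.prod_eq_zero ht h0

lemma totalDegree_det_le {F σ κ : Type*} [Field F] [Fintype κ] [DecidableEq κ]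
    (A : Matrix κ κ (MvPolynomial σ F)) (hA : ∀ i j, (A i j).totalDegree ≤ 1) :
    A.det.totalDegree ≤ Fintype.card κ := by
  rw [Matrix.det_apply]
  refine MvPolynomial.totalDegree_finsetSum_le fun g _ => ?_
  refine (MvPolynomial.totalDegree_smul_le _ _).trans ?_
  refine (MvPolynomial.totalDegree_finsetProd _ _).trans ?_
  refine (Finset.sum_le_card_nsmul _ _ 1 fun i _ => hA _ _).trans ?_
  simp

/-- If for every erasure pattern in `s` some specialisation of an affine family of codes corrects
it, then over a large field one specialisation corrects all of them. -/
lemma exists_specialization_corrects {F σ ι κ : Type*} [Field F] [Fintype F] [Finite σ]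
    [Fintype ι] [Fintype κ]
    (M : Matrix ι κ (MvPolynomial σ F)) (hM : ∀ i j, (M i j).totalDegree ≤ 1)
    (s : Finset (Finset ι)) (hcard : s.card * Fintype.card κ < Fintype.card F)
    (hs : ∀ T ∈ s, ∃ θ : σ → F, ∀ x : κ → F,
      (∀ i ∉ T, (M.map (MvPolynomial.eval θ) *ᵥ x) i = 0) → x = 0) :
    ∃ θ : σ → F, ∀ T ∈ s, ∀ x : κ → F,
      (∀ i ∉ T, (M.map (MvPolynomial.eval θ) *ᵥ x) i = 0) → x = 0 := by
  classical
  have key : ∀ T ∈ s, ∃ N : Matrix κ ι F, (∀ i ∈ T, ∀ j, N j i = 0) ∧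
      ∃ θ : σ → F, (N * M.map (MvPolynomial.eval θ)).det ≠ 0 := by
    intro T hT
    obtain ⟨θ, hθ⟩ := hs T hT
    let mask : Matrix ι ι F := Matrix.diagonal fun i => if i ∈ T then 0 else 1
    have hinj : LinearMap.ker (mask * M.map (MvPolynomial.eval θ)).mulVecLin = ⊥ := by
      refine LinearMap.ker_eq_bot'.2 fun x hx => hθ x fun i hi => ?_
      have := congrFun hx i
      rw [Matrix.mulVecLin_apply, ← Matrix.mulVec_mulVec, Matrix.mulVec_diagonal] at this
      simpa [hi] using this
    obtain ⟨g, hg⟩ := LinearMap.exists_leftInverse_of_injective _ hinj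
    refine ⟨LinearMap.toMatrix' g * mask, ?_, θ, ?_⟩
    · intro i hi j
      simp [mask, hi]
    · have : LinearMap.toMatrix' g * (mask * M.map (MvPolynomial.eval θ)) = 1 := by
        have := congrArg LinearMap.toMatrix' hg
        rw [LinearMap.toMatrix'_comp, LinearMap.toMatrix'_id, ← Matrix.toLin'_apply',
          LinearMap.toMatrix'_toLin'] at this
        exact this
      rw [Matrix.mul_assoc, this, Matrix.det_one]
      exact one_ne_zero
  choose! N hN θ₀ hθ₀ using key
  let NC : Finset ι → Matrix κ ι (MvPolynomial σ F) := fun T => (N T).map MvPolynomial.C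
  have heval : ∀ T (θ : σ → F), MvPolynomial.eval θ (NC T * M).det =
      (N T * M.map (MvPolynomial.eval θ)).det := by
    intro T θ
    rw [RingHom.map_det, RingHom.mapMatrix_apply, Matrix.map_mul]
    congr 2
    ext i j
    simp [NC]
  obtain ⟨θ, hθ⟩ := exists_eval_ne_zero_of_card_mul_lt s
    (fun T => (NC T * M).det) (Fintype.card κ)
    (fun T hT h0 => hθ₀ T hT (by rw [← heval, h0, map_zero]))
    (fun T _ => totalDegree_det_le _ fun i j => by
      rw [Matrix.mul_apply]
      refine MvPolynomial.totalDegree_finsetSum_le fun l _ => ?_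
      refine (MvPolynomial.totalDegree_mul _ _).trans ?_
      simpa [NC] using hM l j) hcard
  refine ⟨θ, fun T hT x hx => ?_⟩
  have hdet := hθ T hT
  rw [heval] at hdet
  refine Matrix.eq_zero_of_mulVec_eq_zero hdet ?_
  rw [← Matrix.mulVec_mulVec]
  ext j
  rw [Matrix.mulVec, dotProduct]
  refine Finset.sum_eq_zero fun i _ => ?_
  by_cases hi : i ∈ T
  · rw [hN T hT i hi j, zero_mul]
  · rw [hx i hi, mul_zero]

variable {G A E : Type*} [Fintype G] [Fintype A] [Fintype E]
  [DecidableEq G] [DecidableEq A] [DecidableEq E]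

/-- The points of a code with information symbols `G × A`, the sum of each group `{g} × A` as a
local parity, and the rows of `H` as heavy parities. -/
def points {R : Type*} [CommRing R] (H : E → G × A → R) :
    Matrix ((G × A) ⊕ (G ⊕ E)) (G × A) R
  | .inl p => Pi.single p 1
  | .inr (.inl g) => fun p => if p.1 = g then 1 else 0
  | .inr (.inr i) => H i

/-- Modify row `l` of `θ` so that every column with second index in `Z` sums to zero. -/
def balance {R : Type*} [CommRing R] (Z : Finset A) (l : E) (θ : E × (G × A) → R) :
    E → G × A → R :=
  fun i p => θ (i, p) - if i = l ∧ p.2 ∈ Z then ∑ j, θ (j, p) else 0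

omit [Fintype G] [Fintype A] [DecidableEq G] in
lemma sum_balance {R : Type*} [CommRing R] (Z : Finset A) (l : E) (θ : E × (G × A) → R)
    (p : G × A) (hp : p.2 ∈ Z) : ∑ i, balance Z l θ i p = 0 := by
  simp [balance, hp]

omit [Fintype G] [Fintype A] [DecidableEq G] in
lemma balance_eq_self {R : Type*} [CommRing R] (Z : Finset A) (l : E) (H : E → G × A → R)
    (hH : ∀ p : G × A, p.2 ∈ Z → ∑ i, H i p = 0) :
    balance Z l (fun t => H t.1 t.2) = H := by
  ext i p
  by_cases hp : p.2 ∈ Z <;> simp [balance, hp, hH p]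

section mulVec

variable {F : Type*} [Field F] (H : E → G × A → F) (x : G × A → F)

omit [Fintype E] [DecidableEq E] in
@[simp] lemma points_mulVec_inl (p : G × A) : (points H *ᵥ x) (.inl p) = x p := by
  simp [points, Matrix.mulVec]

omit [Fintype E] [DecidableEq E] in
@[simp] lemma points_mulVec_local (g : G) :
    (points H *ᵥ x) (.inr (.inl g)) = ∑ a, x (g, a) := by
  simp only [points, Matrix.mulVec, dotProduct, Fintype.sum_prod_type]
  rw [Finset.sum_eq_single g] <;> simp +contextual

omit [Fintype E] [DecidableEq E] in
@[simp] lemma points_mulVec_heavy (i : E) :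
    (points H *ᵥ x) (.inr (.inr i)) = H i ⬝ᵥ x := rfl

end mulVec

/-- Heavy parities supported on `Q` that determine a vector supported on `Q` from the heavy
symbols indexed by `K`. -/
lemma exists_heavy_determining {F : Type*} [Field F] (Z : Finset A)
    (Q : Finset (G × A)) (K : Finset E) [Nonempty E] (hQK : Q.card ≤ K.card)
    (hQ : Q.card < Fintype.card E ∨ ∃ q ∈ Q, q.2 ∉ Z) :
    ∃ H : E → G × A → F, (∀ p : G × A, p.2 ∈ Z → ∑ i, H i p = 0) ∧
      ∀ x : G × A → F, (∀ i ∈ K, H i ⬝ᵥ x = 0) → ∀ q ∈ Q, x q = 0 := by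
  obtain ⟨K', hK'K, hK'⟩ := Finset.exists_subset_card_eq hQK
  obtain ⟨φ, hφK, hφ⟩ : ∃ φ : G × A → E, (∀ q ∈ Q, φ q ∈ K) ∧ Set.InjOn φ Q := by
    let e := Finset.equivOfCardEq hK'.symm
    refine ⟨fun p => if h : p ∈ Q then e ⟨p, h⟩ else Classical.arbitrary E, ?_, ?_⟩
    · intro q hq
      simp only [hq, dif_pos]
      exact hK'K (e ⟨q, hq⟩).2
    · intro p hp q hq hpq
      have hp' : p ∈ Q := hp
      have hq' : q ∈ Q := hq
      simp only [hp', hq', dif_pos] at hpq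
      simpa using e.injective (Subtype.ext hpq)
  obtain ⟨i₀, Q', hQ'Q, hi₀, hZ⟩ : ∃ (i₀ : E) (Q' : Finset (G × A)), Q' ⊆ Q ∧
      (∀ q ∈ Q', φ q ≠ i₀) ∧ ∀ q ∈ Q, q ∉ Q' → q.2 ∉ Z := by
    rcases hQ with hlt | ⟨q₀, hq₀, hq₀Z⟩
    · have : (Q.image φ).card < Fintype.card E := Finset.card_image_le.trans_lt hlt
      obtain ⟨i₀, hi₀⟩ : ∃ i₀, i₀ ∉ Q.image φ := by
        by_contra! h
        rw [Finset.eq_univ_of_forall h, Finset.card_univ] at this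
        exact lt_irrefl _ this
      refine ⟨i₀, Q, subset_rfl, fun q hq h => hi₀ (h ▸ Finset.mem_image_of_mem _ hq), ?_⟩
      exact fun q hq hq' => absurd hq hq'
    · refine ⟨φ q₀, Q.erase q₀, Finset.erase_subset _ _, fun q hq h => ?_, fun q hq hq' => ?_⟩
      · exact Finset.ne_of_mem_erase hq (hφ (Finset.mem_of_mem_erase hq) hq₀ h)
      · have : q = q₀ := by simpa [hq] using hq'
        exact this ▸ hq₀Z
  let H : E → G × A → F := fun i p =>
    (if p ∈ Q ∧ φ p = i then 1 else 0) - if i = i₀ ∧ p ∈ Q' then 1 else 0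
  have hdot : ∀ x : G × A → F, ∀ q ∈ Q,
      H (φ q) ⬝ᵥ x = x q - if φ q = i₀ then ∑ p ∈ Q', x p else 0 := by
    intro x q hq
    simp only [H, dotProduct, sub_mul, Finset.sum_sub_distrib]
    congr 1
    · rw [Finset.sum_eq_single q]
      · simp [hq]
      · intro p _ hpq
        rw [if_neg (fun h => hpq (hφ h.1 hq h.2)), zero_mul]
      · simp
    · by_cases h : φ q = i₀ <;> simp [h]
  refine ⟨H, fun p hp => ?_, fun x hx => ?_⟩
  · by_cases hpQ : p ∈ Q
    · have : p ∈ Q' := by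
        by_contra h
        exact hZ p hpQ h hp
      simp [H, hpQ, this]
    · have : p ∉ Q' := fun h => hpQ (hQ'Q h)
      simp [H, hpQ, this]
  · have hx' : ∀ q ∈ Q', x q = 0 := by
      intro q hq
      have := hdot x q (hQ'Q hq)
      rw [hx _ (hφK q (hQ'Q hq)), if_neg (hi₀ q hq), sub_zero] at this
      exact this.symm
    intro q hq
    have := hdot x q hq
    rw [hx _ (hφK q hq), Finset.sum_eq_zero hx', ite_self, sub_zero] at this
    exact this.symm

/-- Every pattern of at most `|E| + 1` erasures is corrected by some balanced choice of heavy
parities. -/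
lemma exists_heavy_corrects {F : Type*} [Field F] [Nonempty A] [Nonempty E] (Z : Finset A)
    (hZ : Z.card < Fintype.card E) (T : Finset ((G × A) ⊕ (G ⊕ E)))
    (hT : T.card ≤ Fintype.card E + 1) :
    ∃ H : E → G × A → F, (∀ p : G × A, p.2 ∈ Z → ∑ i, H i p = 0) ∧
      ∀ x : G × A → F, (∀ i ∉ T, (points H *ᵥ x) i = 0) → x = 0 := by
  have hb : ∀ g : G, ∃ b : A, ∀ a, .inl (g, a) ∈ T → .inl (g, b) ∈ T := by
    intro g
    by_cases h : ∃ a, .inl (g, a) ∈ T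
    · exact ⟨h.choose, fun _ _ => h.choose_spec⟩
    · exact ⟨Classical.arbitrary A, fun a ha => absurd ⟨a, ha⟩ h⟩
  choose b hb using hb
  let Q : Finset (G × A) :=
    {p | .inl p ∈ T ∧ (.inr (.inl p.1) ∈ T ∨ p.2 ≠ b p.1)}
  let K : Finset E := {i | .inr (.inr i) ∉ T}
  let hit : Finset G := Q.image Prod.fst
  let ρ : G → (G × A) ⊕ (G ⊕ E) := fun g => if .inr (.inl g) ∈ T then .inr (.inl g)
    else .inl (g, b g)
  have hcount : Q.card + hit.card + Kᶜ.card ≤ T.card := by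
    have hρ : Function.Injective ρ := by
      intro g g' h
      simp only [ρ] at h
      split_ifs at h <;> simp_all
    have hE : Function.Injective (fun i : E => (.inr (.inr i) : (G × A) ⊕ (G ⊕ E))) :=
      fun i j h => by simpa using h
    have h1 : Disjoint (Q.image (.inl : G × A → (G × A) ⊕ (G ⊕ E))) (hit.image ρ) := by
      rw [Finset.disjoint_left]
      rintro _ hp hg
      obtain ⟨p, hp, rfl⟩ := Finset.mem_image.1 hp
      obtain ⟨g, hg, hgp⟩ := Finset.mem_image.1 hg
      simp only [ρ] at hgp
      split_ifs at hgp with h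
      obtain rfl : (g, b g) = p := by simpa using hgp
      simp [Q, h] at hp
    have h2 : Disjoint (Q.image (.inl : G × A → (G × A) ⊕ (G ⊕ E)) ∪ hit.image ρ)
        (Kᶜ.image fun i => .inr (.inr i)) := by
      rw [Finset.disjoint_right]
      rintro _ hi h
      obtain ⟨i, hi, rfl⟩ := Finset.mem_image.1 hi
      rcases Finset.mem_union.1 h with h | h
      · simp at h
      · obtain ⟨g, -, hg⟩ := Finset.mem_image.1 h
        simp only [ρ] at hg
        split_ifs at hg
        simp at hg
    rw [← Finset.card_image_of_injective Q (Sum.inl_injective (β := G ⊕ E)),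
      ← Finset.card_image_of_injective hit hρ, ← Finset.card_image_of_injective Kᶜ hE,
      ← Finset.card_union_of_disjoint h1, ← Finset.card_union_of_disjoint h2]
    refine Finset.card_le_card fun t ht => ?_
    rcases Finset.mem_union.1 ht with ht | ht
    · rcases Finset.mem_union.1 ht with ht | ht
      · obtain ⟨p, hp, rfl⟩ := Finset.mem_image.1 ht
        exact (Finset.mem_filter.1 hp).2.1
      · obtain ⟨g, hg, rfl⟩ := Finset.mem_image.1 ht
        obtain ⟨p, hp, rfl⟩ := Finset.mem_image.1 hg
        simp only [ρ]
        split_ifs with h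
        · exact h
        · exact hb p.1 p.2 (Finset.mem_filter.1 hp).2.1
    · obtain ⟨i, hi, rfl⟩ := Finset.mem_image.1 ht
      simpa [K] using hi
  have hK : K.card + Kᶜ.card = Fintype.card E := Finset.card_add_card_compl K
  have hpos : Q.Nonempty → 0 < hit.card := fun h => Finset.card_pos.2 (h.image _)
  have hQK : Q.card ≤ K.card := by
    rcases Q.eq_empty_or_nonempty with h | h
    · simp [h]
    · have := hpos h
      omega
  have hQ : Q.card < Fintype.card E ∨ ∃ q ∈ Q, q.2 ∉ Z := by
    by_contra! h
    obtain ⟨hle, hQZ⟩ := h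
    have hne : Q.Nonempty := Finset.card_pos.1 (by omega)
    have hhit : hit.card ≤ 1 := by omega
    have hinj : Set.InjOn Prod.snd (Q : Set (G × A)) := fun p hp q hq hpq =>
      Prod.ext (Finset.card_le_one.1 hhit _ (Finset.mem_image_of_mem _ hp) _
        (Finset.mem_image_of_mem _ hq)) hpq
    have := Finset.card_le_card_of_injOn _ hQZ hinj
    omega
  obtain ⟨H, hH, hdet⟩ := exists_heavy_determining (F := F) Z Q K hQK hQ
  refine ⟨H, hH, fun x hx => ?_⟩
  have hxQ := hdet x fun i hi => by
    simpa using hx (.inr (.inr i)) (by simpa [K] using hi)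
  have hrest : ∀ g a, a ≠ b g ∨ .inr (.inl g) ∈ T → x (g, a) = 0 := by
    intro g a h
    by_cases hT : .inl (g, a) ∈ T
    · exact hxQ _ (by simp [Q, hT]; tauto)
    · simpa using hx _ hT
  ext ⟨g, a⟩
  by_cases hg : .inr (.inl g) ∈ T
  · exact hrest g a (.inr hg)
  · by_cases ha : a = b g
    · have := hx _ hg
      rw [points_mulVec_local, Finset.sum_eq_single a] at this
      · exact this
      · exact fun a' _ h => hrest g a' (.inl (ha ▸ h))
      · simp
    · exact hrest g a (.inl ha)

/-- Balanced heavy parities for which the code corrects every pattern of `|E| + 1` erasures. -/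
lemma exists_heavy_corrects_all {F : Type*} [Field F] [Fintype F] [Nonempty A] [Nonempty E]
    (Z : Finset A) (hZ : Z.card < Fintype.card E)
    (hF : (Fintype.card ((G × A) ⊕ (G ⊕ E))).choose (Fintype.card E + 1) *
      Fintype.card (G × A) < Fintype.card F) :
    ∃ H : E → G × A → F, (∀ p : G × A, p.2 ∈ Z → ∑ i, H i p = 0) ∧
      ∀ T : Finset ((G × A) ⊕ (G ⊕ E)), T.card = Fintype.card E + 1 →
        ∀ x : G × A → F, (∀ i ∉ T, (points H *ᵥ x) i = 0) → x = 0 := by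
  let l : E := Classical.arbitrary E
  let M : Matrix ((G × A) ⊕ (G ⊕ E)) (G × A) (MvPolynomial (E × (G × A)) F) :=
    points (balance Z l MvPolynomial.X)
  have heval : ∀ θ : E × (G × A) → F,
      M.map (MvPolynomial.eval θ) = points (balance Z l θ) := by
    intro θ
    ext (p | g | i) q
    · by_cases h : q = p <;> simp [M, points, h]
    · by_cases h : q.1 = g <;> simp [M, points, h]
    · by_cases h : i = l ∧ q.2 ∈ Z <;> simp [M, points, balance, h]
  have hdeg : ∀ i j, (M i j).totalDegree ≤ 1 := by
    rintro (p | g | i) q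
    · by_cases h : q = p <;> simp [M, points, h]
    · by_cases h : q.1 = g <;> simp [M, points, h]
    · simp only [M, points, balance]
      refine (MvPolynomial.totalDegree_sub _ _).trans (max_le (by simp) ?_)
      split_ifs
      · exact MvPolynomial.totalDegree_finsetSum_le fun j _ => by simp
      · simp
  obtain ⟨θ, hθ⟩ := exists_specialization_corrects M hdeg
    (Finset.univ.powersetCard (Fintype.card E + 1))
    (by rwa [Finset.card_powersetCard, Finset.card_univ]) (fun T hT => by
      obtain ⟨H, hH, hx⟩ := exists_heavy_corrects (F := F) Z hZ T
        (Finset.mem_powersetCard.1 hT).2.le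
      refine ⟨fun t => H t.1 t.2, ?_⟩
      rw [heval, balance_eq_self Z l H hH]
      exact hx)
  refine ⟨balance Z l θ, sum_balance Z l θ, fun T hT => ?_⟩
  rw [← heval]
  exact hθ T (Finset.mem_powersetCard.2 ⟨Finset.subset_univ _, hT⟩)

omit [Fintype G] [Fintype E] [DecidableEq E] in
lemma points_local_eq_sum {R : Type*} [CommRing R] (H : E → G × A → R) (g : G) :
    points H (.inr (.inl g)) = ∑ a, points H (.inl (g, a)) := by
  ext ⟨g', a'⟩
  by_cases h : g' = g <;> simp [points, Finset.sum_apply, Pi.single_apply, h]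

omit [Fintype G] [Fintype E] in
/-- Information symbols and local parities lie in the span of the other points of their group. -/
lemma exists_repair_info {F : Type*} [Field F] (H : E → G × A → F) (p : G × A) :
    ∃ R : Finset ((G × A) ⊕ (G ⊕ E)), .inl p ∉ R ∧ R.card ≤ Fintype.card A ∧
      points H (.inl p) ∈ Submodule.span F (points H '' R) := by
  obtain ⟨g, a⟩ := p
  refine ⟨insert (.inr (.inl g)) ((Finset.univ.erase a).image fun b => .inl (g, b)), by simp,
    ?_, ?_⟩
  · refine (Finset.card_insert_le _ _).trans ?_
    have h1 := Finset.card_image_le (s := Finset.univ.erase a)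
      (f := fun b => (.inl (g, b) : (G × A) ⊕ (G ⊕ E)))
    have h2 : (Finset.univ.erase a).card + 1 = Fintype.card A :=
      Finset.card_erase_add_one (Finset.mem_univ a)
    omega
  · have : points H (.inl (g, a)) =
        points H (.inr (.inl g)) - ∑ b ∈ Finset.univ.erase a, points H (.inl (g, b)) := by
      rw [points_local_eq_sum, eq_sub_iff_add_eq, add_comm]
      exact Finset.sum_erase_add _ _ (Finset.mem_univ a)
    rw [this]
    refine sub_mem (Submodule.subset_span ⟨_, by simp, rfl⟩)
      (sum_mem fun b hb => Submodule.subset_span ⟨_, ?_, rfl⟩)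
    simpa using hb

omit [Fintype G] [Fintype E] in
lemma exists_repair_local {F : Type*} [Field F] (H : E → G × A → F) (g : G) :
    ∃ R : Finset ((G × A) ⊕ (G ⊕ E)), .inr (.inl g) ∉ R ∧ R.card ≤ Fintype.card A ∧
      points H (.inr (.inl g)) ∈ Submodule.span F (points H '' R) := by
  refine ⟨Finset.univ.image fun b => .inl (g, b), by simp, Finset.card_image_le, ?_⟩
  rw [points_local_eq_sum]
  exact sum_mem fun b _ => Submodule.subset_span ⟨_, by simp, rfl⟩

lemma exists_repair_heavy {F : Type*} [Field F] (H : E → G × A → F) (Z : Finset A)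
    (hH : ∀ p : G × A, p.2 ∈ Z → ∑ i, H i p = 0) (i : E) :
    ∃ R : Finset ((G × A) ⊕ (G ⊕ E)), .inr (.inr i) ∉ R ∧
      R.card ≤ Fintype.card G * Zᶜ.card + (Fintype.card E - 1) ∧
      points H (.inr (.inr i)) ∈ Submodule.span F (points H '' R) := by
  refine ⟨(Finset.univ ×ˢ Zᶜ).image .inl ∪ (Finset.univ.erase i).image fun j => .inr (.inr j),
    by simp, ?_, ?_⟩
  · refine (Finset.card_union_le _ _).trans (add_le_add ?_ ?_)
    · refine Finset.card_image_le.trans ?_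
      rw [Finset.card_product, Finset.card_univ]
    · refine Finset.card_image_le.trans ?_
      rw [Finset.card_erase_of_mem (Finset.mem_univ i), Finset.card_univ]
  · have : points H (.inr (.inr i)) =
        ∑ p ∈ Finset.univ ×ˢ Zᶜ, (∑ j, H j p) • points H (.inl p) -
          ∑ j ∈ Finset.univ.erase i, points H (.inr (.inr j)) := by
      rw [eq_sub_iff_add_eq, add_comm, Finset.sum_erase_add _ _ (Finset.mem_univ i)]
      ext q
      simp only [points, Finset.sum_apply, Pi.smul_apply, Pi.single_apply, smul_eq_mul, mul_ite,
        mul_one, mul_zero, Finset.sum_ite_eq]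
      split_ifs with h
      · rfl
      · exact hH q (by simpa using h)
    rw [this]
    refine sub_mem (sum_mem fun p hp => Submodule.smul_mem _ _ (Submodule.subset_span ⟨_, ?_, rfl⟩))
      (sum_mem fun j hj => Submodule.subset_span ⟨_, ?_, rfl⟩)
    · simpa using hp
    · simpa using hj

/-- A nonzero word of weight at most `|E| + 2`. -/
lemma exists_low_weight {F : Type*} [Field F] [DecidableEq F] [Nonempty G] [Nonempty A]
    (H : E → G × A → F) :
    ∃ x : G × A → F, x ≠ 0 ∧
      (Finset.univ.filter fun i => (points H *ᵥ x) i ≠ 0).card ≤ Fintype.card E + 2 := by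
  obtain ⟨g⟩ := ‹Nonempty G›
  obtain ⟨a⟩ := ‹Nonempty A›
  have hcard : ∀ u v : (G × A) ⊕ (G ⊕ E),
      ({u, v} ∪ Finset.univ.image fun i => .inr (.inr i)).card ≤ Fintype.card E + 2 := by
    intro u v
    refine (Finset.card_union_le _ _).trans ?_
    rw [add_comm]
    exact add_le_add Finset.card_image_le Finset.card_le_two
  by_cases h : ∃ b, b ≠ a
  · obtain ⟨b, hb⟩ := h
    refine ⟨Pi.single (g, a) 1 - Pi.single (g, b) 1, fun h0 => ?_, le_trans
      (Finset.card_le_card ?_) (hcard (.inl (g, a)) (.inl (g, b)))⟩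
    · simpa [hb.symm] using congrFun h0 (g, a)
    · rintro (p | g' | i) hp
      · by_contra hn
        simp only [Finset.mem_union, Finset.mem_insert, Finset.mem_singleton, Sum.inl.injEq,
          not_or] at hn
        simp [hn.1.1, hn.1.2] at hp
      · simp only [Finset.mem_filter, points_mulVec_local] at hp
        by_cases hg : g' = g <;> simp [Pi.single_apply, hg] at hp
      · simp
  · push Not at h
    refine ⟨Pi.single (g, a) 1, fun h0 => ?_, le_trans
      (Finset.card_le_card ?_) (hcard (.inl (g, a)) (.inr (.inl g)))⟩
    · simpa using congrFun h0 (g, a)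
    · rintro (p | g' | i) hp
      · by_contra hn
        simp only [Finset.mem_union, Finset.mem_insert, Finset.mem_singleton, Sum.inl.injEq,
          not_or] at hn
        rw [Finset.mem_filter, points_mulVec_inl] at hp
        simp [hn.1.1] at hp
      · simp only [Finset.mem_filter, points_mulVec_local] at hp
        by_cases hg : g' = g
        · simp [hg]
        · simp [hg] at hp
      · simp

/-- Reindex the points `M` of a code by `Fin n` and their coordinates by `Fin k`. -/
def reindexed {ι κ F : Type*} {n k : ℕ} (σ : ι ≃ Fin n) (τ : κ ≃ Fin k) (M : Matrix ι κ F) :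
    Fin n → Fin k → F :=
  fun i j => M (σ.symm i) (τ.symm j)

lemma locLE_reindexed {ι κ : Type*} {F : Type} [Field F] {n k s : ℕ} (σ : ι ≃ Fin n)
    (τ : κ ≃ Fin k) (M : Matrix ι κ F) (a : ι) (R : Finset ι) (ha : a ∉ R) (hR : R.card ≤ s)
    (hspan : M a ∈ Submodule.span F (M '' R)) : LocLE (reindexed σ τ M) (σ a) s := by
  obtain ⟨lam, hlam⟩ := (Submodule.mem_span_image_finset_iff_exists_fun F).1 hspan
  obtain ⟨lam', hlam'⟩ : ∃ lam' : ι → F, ∀ i : R, lam' i = lam i :=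
    ⟨Function.extend Subtype.val lam 0, Subtype.val_injective.extend_apply lam 0⟩
  have hsum : M a = ∑ i ∈ R, lam' i • M i := by
    rw [← hlam, ← Finset.sum_coe_sort R]
    exact Finset.sum_congr rfl fun i _ => by rw [hlam']
  refine ⟨R.map σ.toEmbedding, by simpa using ha, by simpa using hR, fun j => lam' (σ.symm j), ?_⟩
  ext j
  simp [reindexed, hsum, Finset.sum_apply]

lemma reindexed_dotProduct {ι κ : Type*} {F : Type} [Fintype κ] [Field F] {n k : ℕ}
    (σ : ι ≃ Fin n) (τ : κ ≃ Fin k) (M : Matrix ι κ F) (x : Fin k → F) (i : ι) :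
    reindexed σ τ M (σ i) ⬝ᵥ x = (M *ᵥ (x ∘ τ)) i := by
  simp only [reindexed, dotProduct, Matrix.mulVec, Equiv.symm_apply_apply]
  rw [← Equiv.sum_comp τ]
  simp

lemma codewordWeight_reindexed {ι κ : Type*} {F : Type} [Fintype ι] [Fintype κ] [Field F]
    [DecidableEq F] {n k : ℕ} (σ : ι ≃ Fin n) (τ : κ ≃ Fin k) (M : Matrix ι κ F)
    (x : Fin k → F) :
    codewordWeight (reindexed σ τ M) x =
      (Finset.univ.filter fun i => (M *ᵥ (x ∘ τ)) i ≠ 0).card := by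
  refine (Finset.card_equiv σ fun i => ?_).symm
  simp [reindexed_dotProduct]

lemma hasDistance_reindexed {F : Type} [Field F] [DecidableEq F] [Nonempty G] [Nonempty A]
    {n k : ℕ} (σ : (G × A) ⊕ (G ⊕ E) ≃ Fin n) (τ : G × A ≃ Fin k) (H : E → G × A → F)
    (hH : ∀ T : Finset ((G × A) ⊕ (G ⊕ E)), T.card = Fintype.card E + 1 →
        ∀ x : G × A → F, (∀ i ∉ T, (points H *ᵥ x) i = 0) → x = 0) :
    HasDistance (reindexed σ τ (points H)) (Fintype.card E + 2) := by
  have hlow : ∀ x : Fin k → F, x ≠ 0 →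
      Fintype.card E + 2 ≤ codewordWeight (reindexed σ τ (points H)) x := by
    intro x hx
    rw [codewordWeight_reindexed]
    by_contra! hlt
    have hι : Fintype.card E + 1 ≤ Fintype.card ((G × A) ⊕ (G ⊕ E)) := by
      have := Fintype.card_pos (α := G)
      simp only [Fintype.card_sum]
      omega
    obtain ⟨T, hT, hTc⟩ := Finset.exists_superset_card_eq (Nat.le_of_lt_succ hlt) hι
    have h0 := hH T hTc (x ∘ τ) fun i hi => by
      by_contra h
      exact hi (hT (by simpa using h))
    refine hx (funext fun j => ?_)
    simpa using congrFun h0 (τ.symm j)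
  refine ⟨hlow, ?_⟩
  obtain ⟨y, hy, hyw⟩ := exists_low_weight H
  have hne : y ∘ τ.symm ≠ 0 := fun h => hy (funext fun p => by simpa using congrFun h (τ p))
  refine ⟨y ∘ τ.symm, hne, le_antisymm ?_ (hlow _ hne)⟩
  rw [codewordWeight_reindexed]
  simpa [Function.comp_assoc] using hyw

end LocalParityCode

/-- For 2 < d < r + 3, r < k, r ∣ k, q > k·n^k and n = k + k/r + d − 2, there exists a
    systematic [n,k,d]_q code with information locality r in which k/r parity points have
    locality ≤ r and the remaining d − 2 parity points have locality ≤ k − (k/r − 1)(d − 3). -/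
theorem parity_locality_upper_general
    {F : Type} [Field F] [Fintype F] [DecidableEq F]
    {n k d r : ℕ} (hd2 : 2 < d) (hdr : d < r + 3) (hrlt : r < k) (hrk : r ∣ k)
    (hq : k * n ^ k < Fintype.card F)
    (hn : n = k + k / r + d - 2) :
    ∃ c : Fin n → Fin k → F,
      Submodule.span F (Set.range c) = ⊤ ∧
      HasDistance c d ∧
      InfoLocality c r ∧
      ∃ I P₁ P₂ : Finset (Fin n),
        Disjoint I P₁ ∧ Disjoint I P₂ ∧ Disjoint P₁ P₂ ∧
        I ∪ P₁ ∪ P₂ = Finset.univ ∧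
        -- I indexes the k systematic (information) points
        I.card = k ∧
        (∀ j : Fin k, ∃ i ∈ I, c i = Pi.single j 1) ∧
        (∀ i ∈ I, LocLE c i r) ∧
        -- k/r parity points of locality at most r
        P₁.card = k / r ∧ (∀ i ∈ P₁, LocLE c i r) ∧
        -- the remaining d − 2 parity points of locality at most k − (k/r − 1)(d − 3)
        P₂.card = d - 2 ∧ (∀ i ∈ P₂, LocLE c i (k - (k / r - 1) * (d - 3))) := by
  obtain ⟨m, rfl⟩ := hrk
  have hr : 0 < r := by omega
  have hm : 1 < m := by
    by_contra h
    have : m = 0 ∨ m = 1 := by omega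
    rcases this with rfl | rfl <;> simp at hrlt
  rw [Nat.mul_div_cancel_left m hr] at hn ⊢
  have : Nonempty (Fin m) := ⟨⟨0, by omega⟩⟩
  have : Nonempty (Fin r) := ⟨⟨0, hr⟩⟩
  have : Nonempty (Fin (d - 2)) := ⟨⟨0, by omega⟩⟩
  have hι : Fintype.card ((Fin m × Fin r) ⊕ (Fin m ⊕ Fin (d - 2))) = n := by
    simp only [Fintype.card_sum, Fintype.card_prod, Fintype.card_fin]
    rw [hn, mul_comm m r]
    omega
  have hκ : Fintype.card (Fin m × Fin r) = r * m := by simp [mul_comm]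
  let σ : (Fin m × Fin r) ⊕ (Fin m ⊕ Fin (d - 2)) ≃ Fin n := Fintype.equivFinOfCardEq hι
  let τ : Fin m × Fin r ≃ Fin (r * m) := Fintype.equivFinOfCardEq hκ
  obtain ⟨Z, -, hZ⟩ := Finset.exists_subset_card_eq (s := (Finset.univ : Finset (Fin r)))
    (n := d - 3) (by simp; omega)
  have hchoose : n.choose (d - 2 + 1) * (r * m) < Fintype.card F := by
    refine lt_of_le_of_lt ?_ hq
    rw [mul_comm]
    refine Nat.mul_le_mul_left _ ((Nat.choose_le_pow _ _).trans ?_)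
    exact Nat.pow_le_pow_right (by omega) (by omega)
  obtain ⟨H, hHZ, hH⟩ := LocalParityCode.exists_heavy_corrects_all (G := Fin m) (A := Fin r)
    (E := Fin (d - 2)) (F := F) Z (by simp [hZ]; omega)
    (by rwa [hκ, hι, Fintype.card_fin])
  let c := LocalParityCode.reindexed σ τ (LocalParityCode.points H)
  let I : Finset (Fin n) := Finset.univ.image fun p => σ (.inl p)
  have hsys : ∀ j, ∃ i ∈ I, c i = Pi.single j 1 := by
    intro j
    refine ⟨σ (.inl (τ.symm j)), by simp [I], ?_⟩
    ext j'
    simp [c, LocalParityCode.reindexed, LocalParityCode.points, Pi.single_apply]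
  have hspan : Submodule.span F (c '' I) = ⊤ := by
    rw [eq_top_iff, ← (Pi.basisFun F (Fin (r * m))).span_eq, Submodule.span_le]
    rintro _ ⟨j, rfl⟩
    obtain ⟨i, hi, hij⟩ := hsys j
    exact Submodule.subset_span ⟨i, hi, by simp [hij]⟩
  have hI : ∀ i ∈ I, LocLE c i r := by
    intro i hi
    obtain ⟨p, -, rfl⟩ := Finset.mem_image.1 hi
    obtain ⟨R, hR, hRc, hRs⟩ := LocalParityCode.exists_repair_info H p
    exact LocalParityCode.locLE_reindexed σ τ _ _ R hR (by simpa using hRc) hRs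
  refine ⟨c, top_unique (hspan ▸ Submodule.span_mono (Set.image_subset_range _ _)), ?_,
    ⟨I, hspan, hI⟩, I, Finset.univ.image fun g => σ (.inr (.inl g)),
    Finset.univ.image fun i => σ (.inr (.inr i)), ?_, ?_, ?_, ?_, ?_, hsys, hI, ?_, ?_, ?_, ?_⟩
  · have := LocalParityCode.hasDistance_reindexed σ τ H hH
    rwa [Fintype.card_fin, Nat.sub_add_cancel hd2.le] at this
  · refine Finset.disjoint_left.2 fun i h₁ h₂ => ?_
    obtain ⟨p, -, rfl⟩ := Finset.mem_image.1 h₁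
    simp at h₂
  · refine Finset.disjoint_left.2 fun i h₁ h₂ => ?_
    obtain ⟨p, -, rfl⟩ := Finset.mem_image.1 h₁
    simp at h₂
  · refine Finset.disjoint_left.2 fun i h₁ h₂ => ?_
    obtain ⟨g, -, rfl⟩ := Finset.mem_image.1 h₁
    simp at h₂
  · refine Finset.eq_univ_of_forall fun i => ?_
    obtain ⟨t, rfl⟩ := σ.surjective i
    rcases t with p | g | i <;> simp [I]
  · rw [Finset.card_image_of_injective _ fun p q h => by simpa using h, Finset.card_univ, hκ]
  · rw [Finset.card_image_of_injective _ fun p q h => by simpa using h, Finset.card_univ,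
      Fintype.card_fin]
  · intro i hi
    obtain ⟨g, -, rfl⟩ := Finset.mem_image.1 hi
    obtain ⟨R, hR, hRc, hRs⟩ := LocalParityCode.exists_repair_local H g
    exact LocalParityCode.locLE_reindexed σ τ _ _ R hR (by simpa using hRc) hRs
  · rw [Finset.card_image_of_injective _ fun p q h => by simpa using h, Finset.card_univ,
      Fintype.card_fin]
  · intro i hi
    obtain ⟨i, -, rfl⟩ := Finset.mem_image.1 hi
    obtain ⟨R, hR, hRc, hRs⟩ := LocalParityCode.exists_repair_heavy H Z hHZ i
    refine LocalParityCode.locLE_reindexed σ τ _ _ R hR (hRc.trans ?_) hRs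
    rw [Finset.card_compl, hZ, Fintype.card_fin, Fintype.card_fin, Fintype.card_fin]
    obtain ⟨e, rfl⟩ : ∃ e, d = e + 3 := ⟨d - 3, by omega⟩
    obtain ⟨s, rfl⟩ : ∃ s, r = e + s := ⟨r - e, by omega⟩
    obtain ⟨l, rfl⟩ : ∃ l, m = l + 1 := ⟨m - 1, by omega⟩
    simp only [Nat.add_sub_cancel, Nat.add_sub_cancel_left]
    apply Nat.le_sub_of_add_le
    rw [show e + 3 - 2 - 1 = e by omega]
    apply le_of_eq
    ring
end

section
/- Let r < k with r | k, let q ≥ r + 2 be a prime power, and let n = k + k/r + 2. Then there exists a systematic linear [n,k,4]_q code with information locality r in which k/r of the parity points have locality at most r and the remaining 2 parity points have locality at most k − k/r + 1. -/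
open Matrix Finset

section CodeConstruction

open Sum

/-- The matrix with rows `u (u + 1)`, `u + 1`, `u`, extended by an identity block, generates an MDS
code: a nonzero `v` is nonzero in at least four of
its coordinates and of its three parities. -/
theorem four_le_card_support_add_parities {F : Type} [Field F] [DecidableEq F] {r : ℕ}
    {u : Fin r → F} (hu : Function.Injective u) (h0 : ∀ j, u j ≠ 0) (h1 : ∀ j, u j + 1 ≠ 0)
    {v : Fin r → F} (hv : v ≠ 0) :
    4 ≤ (univ.filter fun j => v j ≠ 0).card
      + (if ∑ j, u j * (u j + 1) * v j ≠ 0 then 1 else 0)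
      + (if ∑ j, (u j + 1) * v j ≠ 0 then 1 else 0)
      + (if ∑ j, u j * v j ≠ 0 then 1 else 0) := by
  set S := univ.filter fun j => v j ≠ 0 with hS
  have sum_eq (f : Fin r → F) : ∑ j, f j * v j = ∑ j ∈ S, f j * v j := by
    refine (sum_subset (subset_univ S) fun j _ hj => ?_).symm
    have : v j = 0 := by simpa [hS] using hj
    simp [this]
  have mem {j} (hj : j ∈ S) : v j ≠ 0 := by simpa [hS] using hj
  have hne : S.card ≠ 0 := by
    intro h
    rw [card_eq_zero] at h
    refine hv (funext fun j => ?_)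
    by_contra hj
    have : j ∈ S := by simpa [hS] using hj
    simp [h] at this
  rw [sum_eq, sum_eq, sum_eq]
  rcases (by omega : S.card = 1 ∨ S.card = 2 ∨ S.card = 3 ∨ 4 ≤ S.card) with h | h | h | h
  · obtain ⟨i, hi⟩ := card_eq_one.1 h
    have hvi := mem (j := i) (by simp [hi])
    simp [hi, h0, h1, hvi]
  · obtain ⟨i, j, hij, hi⟩ := card_eq_two.1 h
    have hvi := mem (j := i) (by simp [hi])
    have hd : u i - u j ≠ 0 := sub_ne_zero.2 (hu.ne hij)
    rw [h, hi, sum_pair hij, sum_pair hij, sum_pair hij]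
    have hPA : u i * (u i + 1) * v i + u j * (u j + 1) * v j = 0 →
        (u i + 1) * v i + (u j + 1) * v j ≠ 0 := fun hP hA =>
      mul_ne_zero (mul_ne_zero (h1 i) hd) hvi (by linear_combination hP - u j * hA)
    have hPB : u i * (u i + 1) * v i + u j * (u j + 1) * v j = 0 →
        u i * v i + u j * v j ≠ 0 := fun hP hB =>
      mul_ne_zero (mul_ne_zero (h0 i) hd) hvi (by linear_combination hP - (u j + 1) * hB)
    have hAB : (u i + 1) * v i + (u j + 1) * v j = 0 → u i * v i + u j * v j ≠ 0 := fun hA hB =>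
      mul_ne_zero hd hvi (by linear_combination (u j + 1) * hB - u j * hA)
    split_ifs <;> simp_all
  · obtain ⟨i, j, l, hij, hil, hjl, hi⟩ := card_eq_three.1 h
    have hvi := mem (j := i) (by simp [hi])
    have hd : u i - u j ≠ 0 := sub_ne_zero.2 (hu.ne hij)
    have hd' : u i - u l ≠ 0 := sub_ne_zero.2 (hu.ne hil)
    have sum_three (f : Fin r → F) : ∑ a ∈ ({i, j, l} : Finset (Fin r)), f a = f i + f j + f l := by
      rw [sum_insert (by simp [hij, hil]), sum_pair hjl, add_assoc]
    rw [h, hi, sum_three, sum_three, sum_three]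
    have hPAB : u i * (u i + 1) * v i + u j * (u j + 1) * v j + u l * (u l + 1) * v l = 0 →
        (u i + 1) * v i + (u j + 1) * v j + (u l + 1) * v l = 0 →
        u i * v i + u j * v j + u l * v l ≠ 0 := fun hP hA hB =>
      mul_ne_zero (mul_ne_zero hd hd') hvi (by
        linear_combination hP + u j * u l * hA - (1 + u j + u l + u j * u l) * hB)
    split_ifs <;> simp_all
  · omega

/-- The points of the code: information points `(g, j)`, the local parity of each group `g`, and
two global parities. -/
def parityPoint {F : Type} [Field F] {t r : ℕ} (u : Fin r → F) :
    (Fin t × Fin r) ⊕ (Fin t ⊕ Fin 2) → Fin t × Fin r → F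
  | inl p => Pi.single p 1
  | inr (inl g) => fun p => if p.1 = g then u p.2 * (u p.2 + 1) else 0
  | inr (inr b) => fun p => if b = 0 then u p.2 + 1 else u p.2

theorem parityPoint_global_dotProduct {F : Type} [Field F] {t r : ℕ} (u : Fin r → F)
    (b : Fin 2) (y : Fin t × Fin r → F) :
    parityPoint u (inr (inr b)) ⬝ᵥ y =
      ∑ g, ∑ j, (if b = 0 then u j + 1 else u j) * y (g, j) := by
  simp [parityPoint, dotProduct, Fintype.sum_prod_type]

theorem parityPoint_local_dotProduct {F : Type} [Field F] {t r : ℕ} (u : Fin r → F)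
    (g : Fin t) (y : Fin t × Fin r → F) :
    parityPoint u (inr (inl g)) ⬝ᵥ y = ∑ j, u j * (u j + 1) * y (g, j) := by
  simp only [parityPoint, dotProduct, Fintype.sum_prod_type, ite_mul, zero_mul]
  rw [sum_comm]
  simp

theorem parityPoint_info_dotProduct {F : Type} [Field F] {t r : ℕ} (u : Fin r → F)
    (p : Fin t × Fin r) (y : Fin t × Fin r → F) : parityPoint u (inl p) ⬝ᵥ y = y p := by
  simp [parityPoint]

/-- The weight of a codeword is the sum over groups of information and local parity contributions,
plus the contributions of the two global parities. -/
theorem card_parityPoint_dotProduct_ne_zero {F : Type} [Field F] [DecidableEq F] {t r : ℕ}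
    (u : Fin r → F) (y : Fin t × Fin r → F) :
    (univ.filter fun a => parityPoint u a ⬝ᵥ y ≠ 0).card =
      ∑ g, ((univ.filter fun j => y (g, j) ≠ 0).card
        + (if ∑ j, u j * (u j + 1) * y (g, j) ≠ 0 then 1 else 0))
      + (if ∑ g, ∑ j, (u j + 1) * y (g, j) ≠ 0 then 1 else 0)
      + (if ∑ g, ∑ j, u j * y (g, j) ≠ 0 then 1 else 0) := by
  simp only [card_filter, Fintype.sum_sum_type, parityPoint_global_dotProduct,
    parityPoint_local_dotProduct, parityPoint_info_dotProduct, Fintype.sum_prod_type,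
    Fin.sum_univ_two, sum_add_distrib, add_assoc, if_true, one_ne_zero, if_false]

theorem four_le_card_parityPoint {F : Type} [Field F] [DecidableEq F] {t r : ℕ}
    {u : Fin r → F} (hu : Function.Injective u) (h0 : ∀ j, u j ≠ 0) (h1 : ∀ j, u j + 1 ≠ 0)
    {y : Fin t × Fin r → F} (hy : y ≠ 0) :
    4 ≤ (univ.filter fun a => parityPoint u a ⬝ᵥ y ≠ 0).card := by
  rw [card_parityPoint_dotProduct_ne_zero]
  have group {g : Fin t} (hg : (fun j => y (g, j)) ≠ 0) :=
    four_le_card_support_add_parities hu h0 h1 hg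
  obtain ⟨⟨g, j⟩, hgj⟩ := Function.ne_iff.1 hy
  have hg : (fun j => y (g, j)) ≠ 0 := fun h => hgj (congrFun h j)
  by_cases hother : ∃ g', g' ≠ g ∧ (fun j => y (g', j)) ≠ 0
  · obtain ⟨g', hne, hg'⟩ := hother
    have two {g : Fin t} (hg : (fun j => y (g, j)) ≠ 0) :
        2 ≤ (univ.filter fun j => y (g, j) ≠ 0).card
          + (if ∑ j, u j * (u j + 1) * y (g, j) ≠ 0 then 1 else 0) := by
      have := group hg
      have ite_le (p : Prop) [Decidable p] : (if p then 1 else 0) ≤ 1 := by split_ifs <;> simp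
      have hA := ite_le (∑ j, (u j + 1) * y (g, j) ≠ 0)
      have hB := ite_le (∑ j, u j * y (g, j) ≠ 0)
      omega
    have hpair := sum_le_sum_of_subset (f := fun g =>
      (univ.filter fun j => y (g, j) ≠ 0).card
        + (if ∑ j, u j * (u j + 1) * y (g, j) ≠ 0 then 1 else 0)) (subset_univ {g, g'})
    rw [sum_pair hne.symm] at hpair
    have := two hg
    have := two hg'
    omega
  · push Not at hother
    have hz (g') (hne : g' ≠ g) (j) : y (g', j) = 0 := congrFun (hother g' hne) j
    rw [sum_eq_single g (fun g' _ hne => by simp [hz g' hne]) (by simp),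
      sum_eq_single g (fun g' _ hne => by simp [hz g' hne]) (by simp),
      sum_eq_single g (fun g' _ hne => by simp [hz g' hne]) (by simp)]
    exact group hg

theorem card_parityPoint_single {F : Type} [Field F] [DecidableEq F] {t r : ℕ}
    {u : Fin r → F} (h0 : ∀ j, u j ≠ 0) (h1 : ∀ j, u j + 1 ≠ 0) (p : Fin t × Fin r) :
    (univ.filter fun a => parityPoint u a ⬝ᵥ Pi.single p 1 ≠ 0).card = 4 := by
  simp only [dotProduct_single, mul_one, card_filter, Fintype.sum_sum_type, Fin.sum_univ_two]
  have hl (g : Fin t) : (if p.1 = g then u p.2 * (u p.2 + 1) else 0) ≠ 0 ↔ p.1 = g := by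
    simp [h0, h1]
  have hs (a : Fin t × Fin r) : (Pi.single a 1 : Fin t × Fin r → F) p ≠ 0 ↔ p = a := by
    simp [Pi.single_apply]
  simp only [parityPoint, hl, hs]
  simp [h0, h1]

theorem sum_smul_parityPoint_apply {F : Type} [Field F] {t r : ℕ} (u : Fin r → F)
    (lam : (Fin t × Fin r) ⊕ (Fin t ⊕ Fin 2) → F) (g : Fin t) (j : Fin r) :
    (∑ a, lam a • parityPoint u a) (g, j) =
      lam (inl (g, j)) + (lam (inr (inl g)) * (u j * (u j + 1))
        + (lam (inr (inr 0)) * (u j + 1) + lam (inr (inr 1)) * u j)) := by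
  simp [Finset.sum_apply, Fintype.sum_sum_type, Fin.sum_univ_two, parityPoint, Pi.single_apply]

/-- Locality of a reindexed code, from a combination of points with coefficients vanishing
outside `R`. -/
theorem locLE_reindex {F : Type} [Field F] {n k s : ℕ} {J K : Type} [Fintype J] [DecidableEq J]
    (M : J → K → F) (e : Fin n ≃ J) (f : Fin k ≃ K) {a : J} (R : Finset J) (ha : a ∉ R)
    (hR : R.card ≤ s) (lam : J → F) (hlam : ∀ b ∉ R, lam b = 0)
    (h : M a = ∑ b, lam b • M b) :
    LocLE (fun i l => M (e i) (f l)) (e.symm a) s := by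
  refine ⟨R.map e.symm.toEmbedding, by simpa using ha, by simpa using hR, lam ∘ e, ?_⟩
  ext l
  have hsum : ∑ b, lam b • M b = ∑ b ∈ R, lam b • M b :=
    (sum_subset (subset_univ R) fun b _ hb => by simp [hlam b hb]).symm
  have := congrFun (h.trans hsum) (f l)
  simpa [Finset.sum_apply] using this

section Locality

variable {F : Type} [Field F] {n k t r : ℕ} {u : Fin r → F}
  (e : Fin n ≃ (Fin t × Fin r) ⊕ (Fin t ⊕ Fin 2)) (f : Fin k ≃ Fin t × Fin r)

theorem locLE_info (h0 : ∀ j, u j ≠ 0) (h1 : ∀ j, u j + 1 ≠ 0) (p : Fin t × Fin r) :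
    LocLE (fun i l => parityPoint u (e i) (f l)) (e.symm (inl p)) r := by
  obtain ⟨g, j⟩ := p
  have hr : 0 < r := j.pos
  refine locLE_reindex _ e f
    (insert (inr (inl g)) ((univ.erase j).image fun j' => inl (g, j'))) (by simp) ?_
    (Sum.elim (fun p => if p.1 = g ∧ p.2 ≠ j then
        -(u p.2 * (u p.2 + 1)) / (u j * (u j + 1)) else 0)
      (Sum.elim (Pi.single g (u j * (u j + 1))⁻¹) 0)) ?_ ?_
  · refine (card_insert_le _ _).trans ?_
    have := card_image_le (s := univ.erase j)
      (f := fun j' => (inl (g, j') : (Fin t × Fin r) ⊕ (Fin t ⊕ Fin 2)))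
    rw [card_erase_of_mem (mem_univ j), card_univ, Fintype.card_fin] at this
    omega
  · rintro (⟨g', j'⟩ | g' | b) hb
    · simp at hb ⊢
      grind
    · simp at hb ⊢
      simp [hb]
    · simp
  · ext ⟨g', j'⟩
    rw [sum_smul_parityPoint_apply]
    have := h0 j
    have := h1 j
    by_cases hg : g' = g
    · subst hg
      by_cases hj : j' = j
      · subst hj
        simp [parityPoint]
        field_simp
      · simp [parityPoint, hj]
        field_simp
        ring
    · simp [parityPoint, hg]

theorem locLE_local (g : Fin t) :
    LocLE (fun i l => parityPoint u (e i) (f l)) (e.symm (inr (inl g))) r := by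
  refine locLE_reindex _ e f (univ.image fun j => inl (g, j)) (by simp)
    (card_image_le.trans (by simp))
    (Sum.elim (fun p => if p.1 = g then u p.2 * (u p.2 + 1) else 0) 0) ?_ ?_
  · rintro (⟨g', j'⟩ | b) hb
    · simp at hb ⊢
      grind
    · simp
  · ext ⟨g', j'⟩
    rw [sum_smul_parityPoint_apply]
    simp [parityPoint]

theorem locLE_global (h0 : ∀ j, u j ≠ 0) (h1 : ∀ j, u j + 1 ≠ 0) (j : Fin r) (b : Fin 2) :
    LocLE (fun i l => parityPoint u (e i) (f l)) (e.symm (inr (inr b))) (t * (r - 1) + 1) := by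
  have hcoef (b : Fin 2) : (if b = 0 then u j + 1 else u j) ≠ 0 := by
    split_ifs
    exacts [h1 j, h0 j]
  set w : Fin 2 → Fin r → F := fun b i => if b = 0 then u i + 1 else u i with hw
  refine locLE_reindex _ e f
    (insert (inr (inr (1 - b))) ((univ ×ˢ univ.erase j).image inl)) ?_ ?_
    (Sum.elim (fun p => w b p.2 - w b j / w (1 - b) j * w (1 - b) p.2)
      (Sum.elim 0 (Pi.single (1 - b) (w b j / w (1 - b) j)))) ?_ ?_
  · fin_cases b <;> simp
  · refine (card_insert_le _ _).trans ?_
    have := card_image_le (s := (univ : Finset (Fin t)) ×ˢ univ.erase j)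
      (f := (inl : _ → (Fin t × Fin r) ⊕ (Fin t ⊕ Fin 2)))
    rw [card_product, card_erase_of_mem (mem_univ j), card_univ, card_univ, Fintype.card_fin,
      Fintype.card_fin] at this
    omega
  · rintro (⟨g', j'⟩ | g' | b') hb
    · have hj : j' = j := by simpa using hb
      have : w (1 - b) j ≠ 0 := hcoef _
      subst hj
      simp
      field_simp
      ring
    · simp
    · have hb' : b' ≠ 1 - b := by simpa using hb
      simp [hb']
  · ext ⟨g', j'⟩
    rw [sum_smul_parityPoint_apply]
    fin_cases b <;> simp [parityPoint, hw]

end Locality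

/-- A field with at least `r + 2` elements has `r` distinct elements other than `0` and `-1`. -/
theorem exists_injective_ne_zero_add_one_ne_zero {F : Type} [Field F] [Fintype F] [DecidableEq F]
    {r : ℕ} (hq : r + 2 ≤ Fintype.card F) :
    ∃ u : Fin r → F, Function.Injective u ∧ (∀ j, u j ≠ 0) ∧ ∀ j, u j + 1 ≠ 0 := by
  have hcard : r ≤ (({0, -1} : Finset F)ᶜ).card := by
    have := card_le_two (a := (0 : F)) (b := -1)
    rw [card_compl]
    omega
  obtain ⟨T, hT, hTr⟩ := exists_subset_card_eq hcard
  have hmem (j : Fin r) := hT ((T.equivFinOfCardEq hTr).symm j).2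
  simp only [mem_compl, mem_insert, mem_singleton, not_or] at hmem
  exact ⟨fun j => ((T.equivFinOfCardEq hTr).symm j : F),
    Subtype.val_injective.comp (Equiv.injective _), fun j => (hmem j).1,
    fun j h => (hmem j).2 (eq_neg_of_add_eq_zero_left h)⟩

end CodeConstruction

/-- For r < k, r ∣ k, q ≥ r + 2 and n = k + k/r + 2, there exists a systematic
    [n,k,4]_q code with information locality r in which k/r parity points have locality
    ≤ r and the remaining 2 parity points have locality ≤ k − k/r + 1. -/
theorem parity_locality_upper_d4
    {F : Type} [Field F] [Fintype F] [DecidableEq F]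
    {n k r : ℕ} (hrlt : r < k) (hrk : r ∣ k)
    (hq : r + 2 ≤ Fintype.card F)
    (hn : n = k + k / r + 2) :
    ∃ c : Fin n → Fin k → F,
      Submodule.span F (Set.range c) = ⊤ ∧
      HasDistance c 4 ∧
      InfoLocality c r ∧
      ∃ I P₁ P₂ : Finset (Fin n),
        Disjoint I P₁ ∧ Disjoint I P₂ ∧ Disjoint P₁ P₂ ∧
        I ∪ P₁ ∪ P₂ = Finset.univ ∧
        -- I indexes the k systematic (information) points
        I.card = k ∧
        (∀ j : Fin k, ∃ i ∈ I, c i = Pi.single j 1) ∧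
        (∀ i ∈ I, LocLE c i r) ∧
        -- k/r parity points of locality at most r
        P₁.card = k / r ∧ (∀ i ∈ P₁, LocLE c i r) ∧
        -- the remaining 2 parity points of locality at most k − k/r + 1
        P₂.card = 2 ∧ (∀ i ∈ P₂, LocLE c i (k - k / r + 1)) := by
  obtain ⟨t, rfl⟩ := hrk
  have hr : 0 < r := Nat.pos_of_ne_zero fun h => by simp [h] at hrlt
  have ht : 0 < t := Nat.pos_of_ne_zero fun h => by simp [h] at hrlt
  rw [Nat.mul_div_cancel_left t hr] at hn ⊢
  obtain ⟨u, hu, h0, h1⟩ := exists_injective_ne_zero_add_one_ne_zero hq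
  let f : Fin (r * t) ≃ Fin t × Fin r := Fintype.equivOfCardEq (by simp [mul_comm])
  let e : Fin n ≃ (Fin t × Fin r) ⊕ (Fin t ⊕ Fin 2) :=
    Fintype.equivOfCardEq (by simp [hn, mul_comm, add_assoc])
  let c : Fin n → Fin (r * t) → F := fun i l => parityPoint u (e i) (f l)
  have hweight (x : Fin (r * t) → F) : codewordWeight c x =
      (univ.filter fun a => parityPoint u a ⬝ᵥ (x ∘ f.symm) ≠ 0).card := by
    refine card_equiv e fun i => ?_
    have : c i ⬝ᵥ x = parityPoint u (e i) ⬝ᵥ (x ∘ f.symm) := by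
      simp only [dotProduct, c, ← f.sum_comp, Function.comp, Equiv.symm_apply_apply]
    simp [this]
  have hbasis (j : Fin (r * t)) : c (e.symm (Sum.inl (f j))) = Pi.single j 1 := by
    ext l
    simp [c, parityPoint, Pi.single_apply]
  have hinfo (p : Fin t × Fin r) : LocLE c (e.symm (Sum.inl p)) r := locLE_info e f h0 h1 p
  have hspan : Submodule.span F (c '' Set.range fun p => e.symm (Sum.inl p)) = ⊤ := by
    rw [eq_top_iff, ← (Pi.basisFun F (Fin (r * t))).span_eq]
    refine Submodule.span_mono ?_
    rintro _ ⟨j, rfl⟩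
    exact ⟨_, ⟨f j, rfl⟩, by simpa using hbasis j⟩
  refine ⟨c, ?_, ⟨fun x hx => ?_, Pi.single (f.symm (⟨0, ht⟩, ⟨0, hr⟩)) 1, by simp, ?_⟩,
    ⟨_, hspan, by rintro _ ⟨p, rfl⟩; exact hinfo p⟩,
    univ.image fun p => e.symm (Sum.inl p), univ.image fun g => e.symm (Sum.inr (Sum.inl g)),
    univ.image fun b => e.symm (Sum.inr (Sum.inr b)), ?_, ?_, ?_, ?_, ?_, ?_, ?_, ?_, ?_, ?_, ?_⟩
  · exact eq_top_iff.2 (hspan ▸ Submodule.span_mono (Set.image_subset_range _ _))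
  · rw [hweight]
    refine four_le_card_parityPoint hu h0 h1 fun h => hx (funext fun j => ?_)
    simpa using congrFun h (f j)
  · rw [hweight, ← card_parityPoint_single h0 h1 (⟨0, ht⟩, ⟨0, hr⟩)]
    congr! with a
    ext p
    simp [Pi.single_apply]
  · exact disjoint_left.2 (forall_mem_image.2 fun p _ => by simp)
  · exact disjoint_left.2 (forall_mem_image.2 fun p _ => by simp)
  · exact disjoint_left.2 (forall_mem_image.2 fun g _ => by simp)
  · ext i
    obtain ⟨a, rfl⟩ := e.symm.surjective i
    rcases a with p | g | b <;> simp
  · exact (card_image_of_injective _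
      (e.symm.injective.comp Sum.inl_injective)).trans (by simp [mul_comm])
  · exact fun j => ⟨_, mem_image_of_mem _ (mem_univ (f j)), hbasis j⟩
  · exact forall_mem_image.2 fun p _ => hinfo p
  · exact (card_image_of_injective _
      (e.symm.injective.comp (Sum.inr_injective.comp Sum.inl_injective))).trans (by simp)
  · exact forall_mem_image.2 fun g _ => locLE_local e f g
  · exact (card_image_of_injective _
      (e.symm.injective.comp (Sum.inr_injective.comp Sum.inr_injective))).trans (by simp)
  · have hloc : r * t - t + 1 = t * (r - 1) + 1 := by rw [Nat.mul_sub_one, mul_comm]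
    rw [hloc, forall_mem_image]
    exact fun b _ => locLE_global e f h0 h1 ⟨0, hr⟩ b
end

section
/- Let c_1,...,c_h ∈ F_q^k be vectors with supports matching a bipartite graph G that are in general position. Suppose c = Σ_{j∈J} μ_j c_j with μ_j ≠ 0 for all j ∈ J ⊆ [h], and let I = (∪_{j∈J} Γ(j)) \ Supp(c). Then for every nonempty I′ ⊆ I one has |Γ(I′) ∩ J| > |I′|. -/
open Matrix Finset

/-- The vectors `c_1, ..., c_h ∈ F^k` have supports matching the bipartite graph `G`
    given by neighborhoods `Γ : Fin h → Finset (Fin k)`. -/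
def SupportsMatch {k h : ℕ} {F : Type} [Field F]
    (Γ : Fin h → Finset (Fin k)) (c : Fin h → Fin k → F) : Prop :=
  ∀ (j : Fin h) (i : Fin k), c j i ≠ 0 ↔ i ∈ Γ j

/-- The vectors `c_1, ..., c_h` (with supports matching the graph Γ) are in general
    position: for every `I ⊆ [k]` and matching `m` of `I` into `[h]` (so `J = m(I)`),
    the square submatrix `C_{I,J}` is invertible. -/
def GeneralPosition {k h : ℕ} {F : Type} [Field F]
    (Γ : Fin h → Finset (Fin k)) (c : Fin h → Fin k → F) : Prop :=
  ∀ (I : Finset (Fin k)) (m : Fin k → Fin h),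
    Set.InjOn m ↑I → (∀ i ∈ I, i ∈ Γ (m i)) →
    IsUnit (Matrix.of fun a b : ↥I => c (m ↑b) ↑a).det

/-- If every proper nonempty subset of `I` expands strictly, then the neighborhood of `I` in `J`
    also has more than `|I|` elements, provided the combination vanishes on `I`. -/
theorem card_lt_card_neighbors_of_forall_ssubset {F : Type} [Field F] {k h : ℕ}
    {Γ : Fin h → Finset (Fin k)} {c : Fin h → Fin k → F}
    (hmatch : SupportsMatch Γ c) (hgen : GeneralPosition Γ c)
    {J : Finset (Fin h)} {μ : Fin h → F} (hμ : ∀ j ∈ J, μ j ≠ 0)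
    {I : Finset (Fin k)} (hne : I.Nonempty)
    (hcover : ∀ i ∈ I, ∃ j ∈ J, i ∈ Γ j) (hzero : ∀ i ∈ I, ∑ j ∈ J, μ j * c j i = 0)
    (hsub : ∀ A ⊂ I, A.Nonempty → A.card < (J.filter fun j => ∃ i ∈ A, i ∈ Γ j).card) :
    I.card < (J.filter fun j => ∃ i ∈ I, i ∈ Γ j).card := by
  by_contra! hle
  obtain ⟨i₀, hi₀⟩ := hne
  have hall : ∀ A ⊆ I, A.card ≤ (J.filter fun j => ∃ i ∈ A, i ∈ Γ j).card := by
    intro A hA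
    rcases A.eq_empty_or_nonempty with rfl | hAne
    · simp
    rcases hA.eq_or_ssubset with rfl | hss
    · rcases (A.erase i₀).eq_empty_or_nonempty with he | he
      · obtain ⟨j, hj, hij⟩ := hcover i₀ hi₀
        have hpos : 0 < (J.filter fun j => ∃ i ∈ A, i ∈ Γ j).card :=
          Finset.card_pos.mpr ⟨j, Finset.mem_filter.mpr ⟨hj, i₀, hi₀, hij⟩⟩
        have hcard := Finset.card_erase_add_one hi₀
        rw [he, Finset.card_empty] at hcard
        omega
      · have hlt := hsub _ (Finset.erase_ssubset hi₀) he
        have hmono : (J.filter fun j => ∃ i ∈ A.erase i₀, i ∈ Γ j).card ≤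
            (J.filter fun j => ∃ i ∈ A, i ∈ Γ j).card := by
          refine Finset.card_le_card (Finset.monotone_filter_right J ?_)
          rintro j - ⟨i, hi, hij⟩
          exact ⟨i, Finset.mem_of_mem_erase hi, hij⟩
        have hcard := Finset.card_erase_add_one hi₀
        omega
    · exact (hsub A hss hAne).le
  obtain ⟨f, hf, hft⟩ := (Finset.all_card_le_biUnion_card_iff_exists_injective
    (fun i : I => J.filter fun j => (i : Fin k) ∈ Γ j)).mp (by
      intro s
      have hs := hall (s.map (Function.Embedding.subtype _)) (by
        intro x hx
        obtain ⟨y, -, rfl⟩ := Finset.mem_map.mp hx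
        exact y.2)
      rw [Finset.card_map] at hs
      refine hs.trans (Finset.card_le_card fun j hj => ?_)
      obtain ⟨hj, i, hi, hij⟩ := Finset.mem_filter.mp hj
      obtain ⟨y, hy, rfl⟩ := Finset.mem_map.mp hi
      exact Finset.mem_biUnion.mpr ⟨y, hy, Finset.mem_filter.mpr ⟨hj, hij⟩⟩)
  have hfJ : ∀ i, f i ∈ J := fun i => (Finset.mem_filter.mp (hft i)).1
  have hfΓ : ∀ i, (i : Fin k) ∈ Γ (f i) := fun i => (Finset.mem_filter.mp (hft i)).2
  have himage : Finset.univ.image f = J.filter fun j => ∃ i ∈ I, i ∈ Γ j := by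
    refine Finset.eq_of_subset_of_card_le ?_ ?_
    · intro j hj
      obtain ⟨i, -, rfl⟩ := Finset.mem_image.mp hj
      exact Finset.mem_filter.mpr ⟨hfJ i, i, i.2, hfΓ i⟩
    · rw [Finset.card_image_of_injective _ hf]
      simpa using hle
  let m : Fin k → Fin h := fun i => if hi : i ∈ I then f ⟨i, hi⟩ else f ⟨i₀, hi₀⟩
  have hm : ∀ i : I, m i = f i := fun i => by simp [m]
  have hunit := hgen I m
    (fun a ha b hb hab => by
      have := hf ((hm ⟨a, ha⟩).symm.trans (hab.trans (hm ⟨b, hb⟩)))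
      exact congrArg Subtype.val this)
    (fun i hi => by rw [hm ⟨i, hi⟩]; exact hfΓ ⟨i, hi⟩)
  have hker := Matrix.eq_zero_of_mulVec_eq_zero hunit.ne_zero (v := fun b => μ (f b)) (by
    ext a
    calc ∑ b : I, c (m b) a * μ (f b) = ∑ b : I, μ (f b) * c (f b) a :=
          Finset.sum_congr rfl fun b _ => by rw [hm, mul_comm]
      _ = ∑ j ∈ J.filter fun j => ∃ i ∈ I, i ∈ Γ j, μ j * c j a := by
          rw [← himage, Finset.sum_image hf.injOn]
      _ = ∑ j ∈ J, μ j * c j a := by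
          refine Finset.sum_subset (Finset.filter_subset _ _) fun j hj hjn => ?_
          have hc : c j a = 0 := by
            by_contra hc
            exact hjn (Finset.mem_filter.mpr ⟨hj, a, a.2, (hmatch j a).mp hc⟩)
          rw [hc, mul_zero]
      _ = 0 := hzero a a.2)
  exact hμ _ (hfJ ⟨i₀, hi₀⟩) (congrFun hker ⟨i₀, hi₀⟩)

/-- If `c = Σ_{j∈J} μ_j c_j` with all `μ_j ≠ 0` and
    `I = (∪_{j∈J} Γ(j)) \ Supp(c)`, then every nonempty `I′ ⊆ I` satisfies
    `|Γ_J(I′)| > |I′|`. -/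
theorem eliminated_set_expansion
    {F : Type} [Field F] [Fintype F] [DecidableEq F]
    {k h : ℕ}
    (Γ : Fin h → Finset (Fin k)) (c : Fin h → Fin k → F)
    (hmatch : SupportsMatch Γ c) (hgen : GeneralPosition Γ c)
    (J : Finset (Fin h)) (μ : Fin h → F) (hμ : ∀ j ∈ J, μ j ≠ 0)
    (I' : Finset (Fin k))
    (hI' : I' ⊆ (J.biUnion Γ) \
      (Finset.univ.filter fun i : Fin k => (∑ j ∈ J, μ j • c j) i ≠ 0))
    (hne : I'.Nonempty) :
    I'.card < (J.filter fun j => ∃ i ∈ I', i ∈ Γ j).card := by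
  induction I' using Finset.strongInduction with
  | H I ih =>
    refine card_lt_card_neighbors_of_forall_ssubset hmatch hgen hμ hne ?_ ?_
      fun A hA hAne => ih A hA (hA.subset.trans hI') hAne
    · intro i hi
      simpa using (Finset.mem_sdiff.mp (hI' hi)).1
    · intro i hi
      simpa [Finset.sum_apply] using (Finset.mem_sdiff.mp (hI' hi)).2
end

section
/- Let c_1,...,c_h ∈ F_q^k be vectors with supports matching a bipartite graph G that are in general position. If c = Σ_{j∈J} μ_j c_j with μ_j ≠ 0 for all j in a nonempty set J ⊆ [h], then |(∪_{j∈J} Γ(j)) \ Supp(c)| ≤ |J| − 1. -/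
open Matrix Finset

/-- In general position, no combination with nonzero coefficients of the nonempty family `J` vanishes
on a set `E` covered by the neighborhoods of `J` with `J.card ≤ E.card`. -/
theorem GeneralPosition.card_lt_of_sum_eq_zero
    {F : Type} [Field F] {k h : ℕ}
    {Γ : Fin h → Finset (Fin k)} {c : Fin h → Fin k → F}
    (hmatch : SupportsMatch Γ c) (hgen : GeneralPosition Γ c) {μ : Fin h → F}
    (J : Finset (Fin h)) (E : Finset (Fin k)) (hJ : J.Nonempty) (hμ : ∀ j ∈ J, μ j ≠ 0)
    (hE : ∀ i ∈ E, ∃ j ∈ J, i ∈ Γ j) (hsum : ∀ i ∈ E, ∑ j ∈ J, μ j * c j i = 0) :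
    E.card < J.card := by
  induction J using Finset.strongInduction generalizing E with
  | H J ih =>
  by_contra! hcard
  by_cases hall : ∀ s : Finset J, s.card ≤ (s.biUnion fun j => Γ j ∩ E).card
  · obtain ⟨f, hf, hfmem⟩ :=
      (Finset.all_card_le_biUnion_card_iff_exists_injective fun j : J => Γ j ∩ E).1 hall
    obtain ⟨j₀, hj₀⟩ := hJ
    set m : Fin k → Fin h := Function.extend f (fun j => (j : Fin h)) fun _ => j₀
    have hm : ∀ j, m (f j) = j := fun j => hf.extend_apply _ _ j
    have hdet := hgen (Finset.univ.image f) m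
      (by
        intro a ha b hb hab
        simp only [coe_image, coe_univ, Set.image_univ, Set.mem_range] at ha hb
        obtain ⟨x, rfl⟩ := ha
        obtain ⟨y, rfl⟩ := hb
        rw [hm, hm] at hab
        rw [Subtype.ext hab])
      (by
        intro i hi
        obtain ⟨j, -, rfl⟩ := Finset.mem_image.1 hi
        rw [hm]
        exact (Finset.mem_inter.1 (hfmem j)).1)
    have hv := Matrix.eq_zero_of_mulVec_eq_zero hdet.ne_zero
      (v := fun b : ↥(Finset.univ.image f) => μ (m b)) (by
        ext ⟨a, ha⟩
        obtain ⟨x, -, rfl⟩ := Finset.mem_image.1 ha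
        simp only [Matrix.mulVec, dotProduct, Matrix.of_apply, Pi.zero_apply]
        rw [Finset.sum_coe_sort (Finset.univ.image f) fun b => c (m b) (f x) * μ (m b),
          Finset.sum_image hf.injOn, ← hsum (f x) (Finset.mem_inter.1 (hfmem x)).2,
          ← Finset.sum_coe_sort J]
        exact Finset.sum_congr rfl fun j _ => by rw [hm, mul_comm])
    have h0 := congrFun hv ⟨f ⟨j₀, hj₀⟩, Finset.mem_image_of_mem _ (Finset.mem_univ _)⟩
    simp only [hm, Pi.zero_apply] at h0
    exact hμ j₀ hj₀ h0
  · push Not at hall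
    obtain ⟨s, hs⟩ := hall
    set N := s.biUnion fun j => Γ j ∩ E
    set S : Finset (Fin h) := s.map (Function.Embedding.subtype _)
    have hSJ : S ⊆ J := fun j hj => by
      obtain ⟨x, -, rfl⟩ := Finset.mem_map.1 hj
      exact x.2
    have hS : S.card = s.card := Finset.card_map _
    have hNE : N ⊆ E := Finset.biUnion_subset.2 fun j _ => Finset.inter_subset_right
    have hS_not_mem : ∀ i ∈ E \ N, ∀ j ∈ S, i ∉ Γ j := by
      intro i hi j hj hij
      obtain ⟨x, hx, rfl⟩ := Finset.mem_map.1 hj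
      rw [Finset.mem_sdiff] at hi
      exact hi.2 (Finset.mem_biUnion.2 ⟨x, hx, Finset.mem_inter.2 ⟨hij, hi.1⟩⟩)
    have hcover : ∀ i ∈ E \ N, ∃ j ∈ J \ S, i ∈ Γ j := fun i hi => by
      obtain ⟨j, hj, hij⟩ := hE i (Finset.mem_sdiff.1 hi).1
      exact ⟨j, Finset.mem_sdiff.2 ⟨hj, fun hjS => hS_not_mem i hi j hjS hij⟩, hij⟩
    have hcardE := Finset.card_sdiff_add_card_eq_card hNE
    have hcardJ := Finset.card_sdiff_add_card_eq_card hSJ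
    have hne : (J \ S).Nonempty := by
      obtain ⟨i, hi⟩ : (E \ N).Nonempty := Finset.card_pos.1 (by omega)
      obtain ⟨j, hj, -⟩ := hcover i hi
      exact ⟨j, hj⟩
    have hlt := ih (J \ S)
      (Finset.sdiff_ssubset hSJ (Finset.card_pos.1 (by omega))) (E \ N) hne
      (fun j hj => hμ j (Finset.mem_sdiff.1 hj).1) hcover (fun i hi => by
        rw [← hsum i (Finset.mem_sdiff.1 hi).1]
        refine Finset.sum_subset Finset.sdiff_subset fun j hj hjS => ?_
        have hjS' : j ∈ S := by
          by_contra hn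
          exact hjS (Finset.mem_sdiff.2 ⟨hj, hn⟩)
        rw [not_not.1 (mt (hmatch j i).1 (hS_not_mem i hi j hjS')), mul_zero])
    omega

/-- If `c = Σ_{j∈J} μ_j c_j` with all `μ_j ≠ 0` for a nonempty `J`, then the set of
    eliminated coordinates `(∪_{j∈J} Γ(j)) \ Supp(c)` has size at most `|J| − 1`. -/
theorem eliminated_set_card_bound
    {F : Type} [Field F] [Fintype F] [DecidableEq F]
    {k h : ℕ}
    (Γ : Fin h → Finset (Fin k)) (c : Fin h → Fin k → F)
    (hmatch : SupportsMatch Γ c) (hgen : GeneralPosition Γ c)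
    (J : Finset (Fin h)) (hJ : J.Nonempty) (μ : Fin h → F) (hμ : ∀ j ∈ J, μ j ≠ 0) :
    ((J.biUnion Γ) \
      (Finset.univ.filter fun i : Fin k => (∑ j ∈ J, μ j • c j) i ≠ 0)).card ≤
      J.card - 1 := by
  refine Nat.le_sub_one_of_lt
    (GeneralPosition.card_lt_of_sum_eq_zero hmatch hgen J _ hJ hμ ?_ ?_)
  · intro i hi
    exact Finset.mem_biUnion.1 (Finset.mem_sdiff.1 hi).1
  · intro i hi
    simpa [Finset.sum_apply] using (Finset.mem_sdiff.1 hi).2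
end

section
/- Let q ≥ n be a prime power and let V ⊆ F_q^n be a linear subspace. Then the set of supports of vectors in V is closed under union: for any a, b ∈ V there exists c ∈ V with Supp(c) = Supp(a) ∪ Supp(b). -/
open Finset

/-- If q ≥ n, the set of supports of vectors of a linear subspace V ⊆ F_q^n is closed
    under union. -/
theorem supports_closed_under_union
    {F : Type} [Field F] [Fintype F]
    {n : ℕ} (hq : n ≤ Fintype.card F)
    (V : Submodule F (Fin n → F))
    (a b : Fin n → F) (ha : a ∈ V) (hb : b ∈ V) :
    ∃ c ∈ V, ∀ i : Fin n, c i ≠ 0 ↔ (a i ≠ 0 ∨ b i ≠ 0) := by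
  classical
  by_cases hfull : ∀ i, b i ≠ 0
  · exact ⟨b, hb, fun i => by simp [hfull i]⟩
  push Not at hfull
  obtain ⟨j, hj⟩ := hfull
  obtain ⟨t, ht⟩ : ∃ t : F, t ∉ (univ.erase j).image fun i => -a i / b i := by
    by_contra! h
    have hle : Fintype.card F ≤ #((univ.erase j).image fun i => -a i / b i) :=
      card_le_card fun t _ => h t
    have himage := card_image_le (s := univ.erase j) (f := fun i => -a i / b i)
    rw [card_erase_of_mem (mem_univ j), card_univ, Fintype.card_fin] at himage
    have := j.pos
    omega
  refine ⟨a + t • b, V.add_mem ha (V.smul_mem t hb), fun i => ?_⟩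
  by_cases hbi : b i = 0
  · simp [hbi]
  · have hij : i ≠ j := fun h => hbi (h ▸ hj)
    simp only [Pi.add_apply, Pi.smul_apply, smul_eq_mul, ne_eq, hbi, not_false_eq_true,
      or_true, iff_true]
    refine fun h => ht (mem_image.2 ⟨i, mem_erase.2 ⟨hij, mem_univ i⟩, ?_⟩)
    rw [div_eq_iff hbi]
    linear_combination -h
end

section
/- Let q ≥ n be a prime power, and let c_1,...,c_h ∈ F_q^k be vectors with supports matching a bipartite graph G that are in general position, spanning a subspace V ⊆ F_q^k. Then a set S ⊆ [k] is the support of some vector in V if and only if there exist J ⊆ [h] and I ⊆ ∪_{j∈J} Γ(j) such that S = (∪_{j∈J} Γ(j)) \ I and every nonempty subset I′ ⊆ I satisfies |Γ(I′) ∩ J| > |I′|. -/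
open Matrix Finset

/-- A subspace of `F^ι` that vanishes identically on no coordinate of `T` contains a vector
    that is nonzero at every coordinate of `T`, provided `|T| ≤ |F|`. -/
theorem Submodule.exists_mem_forall_apply_ne_zero {F ι : Type*} [Field F] [Fintype F]
    (W : Submodule F (ι → F)) (T : Finset ι) (hT : T.card ≤ Fintype.card F)
    (hW : ∀ i ∈ T, ∃ w ∈ W, w i ≠ 0) : ∃ v ∈ W, ∀ i ∈ T, v i ≠ 0 := by
  classical
  induction T using Finset.induction_on with
  | empty => exact ⟨0, W.zero_mem, by simp⟩
  | insert a T ha ih =>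
    obtain ⟨v, hvW, hv⟩ := ih ((Finset.card_le_card (Finset.subset_insert a T)).trans hT)
      fun i hi => hW i (Finset.mem_insert_of_mem hi)
    obtain ⟨w, hwW, hwa⟩ := hW a (Finset.mem_insert_self a T)
    by_cases hw : ∀ l ∈ insert a T, w l ≠ 0
    · exact ⟨w, hwW, hw⟩
    push Not at hw
    obtain ⟨l, hlT, hl⟩ := hw
    have hcard : (((insert a T).filter (w · ≠ 0)).image fun l => -v l / w l).card <
        Fintype.card F := by
      refine (Finset.card_image_le.trans_lt (Finset.card_lt_card ?_)).trans_le hT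
      exact Finset.filter_ssubset.2 ⟨l, hlT, by simpa using hl⟩
    obtain ⟨t, -, ht⟩ := Finset.exists_mem_notMem_of_card_lt_card
      (hcard.trans_eq Finset.card_univ.symm)
    refine ⟨v + t • w, W.add_mem hvW (W.smul_mem t hwW), fun i hi h0 => ?_⟩
    simp only [Pi.add_apply, Pi.smul_apply, smul_eq_mul] at h0
    by_cases hwi : w i = 0
    · have hia : i ≠ a := by rintro rfl; exact hwa hwi
      exact hv i (Finset.mem_of_mem_insert_of_ne hi hia) (by simpa [hwi] using h0)
    · refine ht (Finset.mem_image.2 ⟨i, Finset.mem_filter.2 ⟨hi, hwi⟩, ?_⟩)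
      rw [div_eq_iff hwi]
      linear_combination -h0

/-- Hall's theorem for a nonempty set `A` of left vertices and a set `J` of right vertices. -/
theorem exists_matching_of_card_le {α β : Type*} [DecidableEq α] [DecidableEq β]
    (Γ : β → Finset α) [∀ B : Finset α, DecidablePred fun j => ∃ i ∈ B, i ∈ Γ j]
    (A : Finset α) (J : Finset β) (hA : A.Nonempty)
    (hall : ∀ B ⊆ A, B.card ≤ (J.filter fun j => ∃ i ∈ B, i ∈ Γ j).card) :
    ∃ m : α → β, Set.InjOn m ↑A ∧ ∀ i ∈ A, m i ∈ J ∧ i ∈ Γ (m i) := by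
  obtain ⟨f, hf, hfm⟩ := (Finset.all_card_le_biUnion_card_iff_exists_injective
    fun i : A => J.filter fun j => (i : α) ∈ Γ j).1 fun s => by
      have hs := hall (s.map (Function.Embedding.subtype _)) fun i hi => by
        obtain ⟨a, -, rfl⟩ := Finset.mem_map.1 hi
        exact a.2
      rw [Finset.card_map] at hs
      refine hs.trans (Finset.card_le_card fun j hj => ?_)
      obtain ⟨hjJ, i, hi, hij⟩ := Finset.mem_filter.1 hj
      obtain ⟨a, ha, rfl⟩ := Finset.mem_map.1 hi
      exact Finset.mem_biUnion.2 ⟨a, ha, Finset.mem_filter.2 ⟨hjJ, hij⟩⟩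
  obtain ⟨a₀, ha₀⟩ := hA
  have hm : ∀ i (hi : i ∈ A), (if hi : i ∈ A then f ⟨i, hi⟩ else f ⟨a₀, ha₀⟩) = f ⟨i, hi⟩ :=
    fun i hi => dif_pos hi
  refine ⟨fun i => if hi : i ∈ A then f ⟨i, hi⟩ else f ⟨a₀, ha₀⟩, fun x hx y hy hxy => ?_,
    fun i hi => ?_⟩
  · simp only [hm x hx, hm y hy] at hxy
    exact congrArg Subtype.val (hf hxy)
  · simp only [hm i hi]
    exact Finset.mem_filter.1 (hfm ⟨i, hi⟩)

/-- Along a matching of `A` into `J`, vectors in general position interpolate arbitrary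
    values on `A`. -/
theorem GeneralPosition.exists_mem_span_eqOn {k h : ℕ} {F : Type} [Field F]
    {Γ : Fin h → Finset (Fin k)} {c : Fin h → Fin k → F} (hgen : GeneralPosition Γ c)
    {A : Finset (Fin k)} {J : Finset (Fin h)} {m : Fin k → Fin h} (hinj : Set.InjOn m ↑A)
    (hm : ∀ i ∈ A, m i ∈ J ∧ i ∈ Γ (m i)) (y : Fin k → F) :
    ∃ w ∈ Submodule.span F (c '' ↑J), ∀ i ∈ A, w i = y i := by
  have hdet := hgen A m hinj fun i hi => (hm i hi).2
  obtain ⟨z, hz⟩ := (Matrix.mulVec_surjective_iff_isUnit.2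
    ((Matrix.isUnit_iff_isUnit_det _).2 hdet)) fun a : A => y a
  refine ⟨∑ b : A, z b • c (m b), Submodule.sum_mem _ fun b _ => Submodule.smul_mem _ _
    (Submodule.subset_span ⟨m b, (hm b b.2).1, rfl⟩), fun i hi => ?_⟩
  rw [← congrFun hz ⟨i, hi⟩]
  simp [Matrix.mulVec, dotProduct, mul_comm]

/-- If `J` is the set of nonzero coefficients of a combination of vectors in general position,
    then every nonempty set of vertices adjacent to `J` where the combination vanishes is
    strictly expanding into `J`. -/
theorem GeneralPosition.card_lt_of_sum_eq_zero_s13 {k h : ℕ} {F : Type} [Field F]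
    {Γ : Fin h → Finset (Fin k)} {c : Fin h → Fin k → F} (hmatch : SupportsMatch Γ c)
    (hgen : GeneralPosition Γ c) {J : Finset (Fin h)} {x : Fin h → F}
    (hx : ∀ j, x j ≠ 0 ↔ j ∈ J) (I : Finset (Fin k)) (hne : I.Nonempty)
    (hIJ : I ⊆ J.biUnion Γ) (hzero : ∀ i ∈ I, ∑ j, x j * c j i = 0) :
    I.card < (J.filter fun j => ∃ i ∈ I, i ∈ Γ j).card := by
  induction I using Finset.strongInduction with
  | H I ih =>
  by_contra! hle
  have hmono : ∀ B ⊆ I, (J.filter fun j => ∃ i ∈ B, i ∈ Γ j) ⊆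
      J.filter fun j => ∃ i ∈ I, i ∈ Γ j := fun B hB =>
    Finset.monotone_filter_right J fun j _ ⟨i, hi, hij⟩ => ⟨i, hB hi, hij⟩
  have hproper : ∀ B ⊂ I, B.Nonempty →
      B.card < (J.filter fun j => ∃ i ∈ B, i ∈ Γ j).card := fun B hB hBne =>
    ih B hB hBne (hB.subset.trans hIJ) fun i hi => hzero i (hB.subset hi)
  have hIle : I.card ≤ (J.filter fun j => ∃ i ∈ I, i ∈ Γ j).card := by
    obtain ⟨a, ha⟩ := hne
    rw [← Finset.card_erase_add_one ha]
    rcases (I.erase a).eq_empty_or_nonempty with he | he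
    · obtain ⟨j, hj, haj⟩ := Finset.mem_biUnion.1 (hIJ ha)
      rw [he]
      exact Finset.card_pos.2 ⟨j, Finset.mem_filter.2 ⟨hj, a, ha, haj⟩⟩
    · exact (hproper _ (Finset.erase_ssubset ha) he).trans_le
        (Finset.card_le_card (hmono _ (Finset.erase_subset a I)))
  have hall : ∀ B ⊆ I, B.card ≤ (J.filter fun j => ∃ i ∈ B, i ∈ Γ j).card := by
    intro B hB
    rcases B.eq_empty_or_nonempty with rfl | hBne
    · simp
    rcases hB.eq_or_ssubset with rfl | hss
    · exact hIle
    · exact (hproper B hss hBne).le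
  obtain ⟨m, hinj, hm⟩ := exists_matching_of_card_le Γ I J hne hall
  have himage : I.image m = J.filter fun j => ∃ i ∈ I, i ∈ Γ j := by
    refine Finset.eq_of_subset_of_card_le (fun j hj => ?_) ?_
    · obtain ⟨i, hi, rfl⟩ := Finset.mem_image.1 hj
      exact Finset.mem_filter.2 ⟨(hm i hi).1, i, hi, (hm i hi).2⟩
    · rwa [Finset.card_image_of_injOn hinj]
  have hdet := hgen I m hinj fun i hi => (hm i hi).2
  have hker : (Matrix.of fun a b : I => c (m b) a) *ᵥ (fun b : I => x (m b)) = 0 := by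
    ext a
    rw [Pi.zero_apply, ← hzero a a.2]
    simp only [Matrix.mulVec, dotProduct, Matrix.of_apply]
    rw [Finset.sum_coe_sort I fun b => c (m b) a * x (m b),
      ← Finset.sum_image (f := fun j => c j a * x j) hinj, himage]
    simp only [mul_comm (c _ _)]
    refine Finset.sum_subset (Finset.subset_univ _) fun j _ hj => ?_
    by_contra hne0
    obtain ⟨hxj, hcj⟩ := mul_ne_zero_iff.1 hne0
    exact hj (Finset.mem_filter.2 ⟨(hx j).1 hxj, a, a.2, (hmatch j a).1 hcj⟩)
  obtain ⟨a, ha⟩ := hne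
  exact (hx (m a)).2 (hm a ha).1
    (congrFun (Matrix.eq_zero_of_mulVec_eq_zero hdet.ne_zero hker) ⟨a, ha⟩)

/-- Characterization of the supports of the span of vectors in general position with
    supports matching `G` (for q at least the ambient dimension): `S` is a support of a
    vector of `V = span{c_j}` iff `S = (∪_{j∈J} Γ(j)) \ I` for some `J` and some `I`
    such that every nonempty `I′ ⊆ I` satisfies `|Γ_J(I′)| > |I′|`. -/
theorem support_characterization
    {F : Type} [Field F] [Fintype F] [DecidableEq F]
    {k h : ℕ} (hq : k ≤ Fintype.card F)
    (Γ : Fin h → Finset (Fin k)) (c : Fin h → Fin k → F)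
    (hmatch : SupportsMatch Γ c) (hgen : GeneralPosition Γ c)
    (S : Finset (Fin k)) :
    (∃ v ∈ Submodule.span F (Set.range c), ∀ i : Fin k, v i ≠ 0 ↔ i ∈ S) ↔
    (∃ (J : Finset (Fin h)) (I : Finset (Fin k)),
      I ⊆ J.biUnion Γ ∧
      S = (J.biUnion Γ) \ I ∧
      ∀ I' ⊆ I, I'.Nonempty →
        I'.card < (J.filter fun j => ∃ i ∈ I', i ∈ Γ j).card) := by
  constructor
  · rintro ⟨v, hv, hS⟩
    obtain ⟨x, rfl⟩ := (Submodule.mem_span_range_iff_exists_fun F).1 hv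
    simp only [Finset.sum_apply, Pi.smul_apply, smul_eq_mul] at hS
    have hSJ : S ⊆ (Finset.univ.filter (x · ≠ 0)).biUnion Γ := fun i hi => by
      obtain ⟨j, -, hj⟩ := Finset.exists_ne_zero_of_sum_ne_zero ((hS i).2 hi)
      obtain ⟨hxj, hcj⟩ := mul_ne_zero_iff.1 hj
      exact Finset.mem_biUnion.2 ⟨j, by simpa using hxj, (hmatch j i).1 hcj⟩
    refine ⟨Finset.univ.filter (x · ≠ 0), (Finset.univ.filter (x · ≠ 0)).biUnion Γ \ S,
      Finset.sdiff_subset, (Finset.sdiff_sdiff_eq_self hSJ).symm, fun I' hI' hne => ?_⟩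
    refine hgen.card_lt_of_sum_eq_zero_s13 hmatch (x := x) (by simp) I' hne
      (hI'.trans Finset.sdiff_subset) fun i hi => ?_
    by_contra h0
    exact (Finset.mem_sdiff.1 (hI' hi)).2 ((hS i).1 h0)
  · rintro ⟨J, I, -, rfl, hI⟩
    have hW : ∀ i ∈ J.biUnion Γ \ I, ∃ w ∈ Submodule.span F (c '' ↑J) ⊓
        ⨅ l ∈ I, LinearMap.ker (LinearMap.proj (R := F) (φ := fun _ : Fin k => F) l),
        w i ≠ 0 := by
      intro i hi
      obtain ⟨hiJ, hiI⟩ := Finset.mem_sdiff.1 hi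
      obtain ⟨m, hinj, hm⟩ := exists_matching_of_card_le Γ (insert i I) J
        (Finset.insert_nonempty i I) fun B hB => by
          have hsub : B.erase i ⊆ I := Finset.subset_insert_iff.1 hB
          have hmono : (J.filter fun j => ∃ l ∈ B.erase i, l ∈ Γ j) ⊆
              J.filter fun j => ∃ l ∈ B, l ∈ Γ j :=
            Finset.monotone_filter_right J fun j _ ⟨l, hl, hlj⟩ =>
              ⟨l, Finset.mem_of_mem_erase hl, hlj⟩
          rcases (B.erase i).eq_empty_or_nonempty with he | he
          · rcases B.eq_empty_or_nonempty with rfl | hB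
            · simp
            have hBi : B = {i} := (Finset.erase_eq_empty_iff B i).1 he |>.resolve_left hB.ne_empty
            obtain ⟨j, hj, hij⟩ := Finset.mem_biUnion.1 hiJ
            have hcard : B.card = 1 := by rw [hBi, Finset.card_singleton]
            rw [hcard]
            exact Finset.card_pos.2 ⟨j, Finset.mem_filter.2 ⟨hj, i, by simp [hBi], hij⟩⟩
          · have := hI _ hsub he
            have := Finset.card_le_card hmono
            have := Finset.pred_card_le_card_erase (s := B) (a := i)
            omega
      obtain ⟨w, hw, hwy⟩ := hgen.exists_mem_span_eqOn hinj hm (Pi.single i 1)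
      refine ⟨w, Submodule.mem_inf.2 ⟨hw, ?_⟩, ?_⟩
      · simp only [Submodule.mem_iInf, LinearMap.mem_ker, LinearMap.proj_apply]
        intro l hl
        rw [hwy l (Finset.mem_insert_of_mem hl), Pi.single_eq_of_ne]
        rintro rfl
        exact hiI hl
      · simp [hwy i (Finset.mem_insert_self i I)]
    obtain ⟨v, hv, hvne⟩ := Submodule.exists_mem_forall_apply_ne_zero _ _
      ((Finset.card_le_univ _).trans (by simpa using hq)) hW
    obtain ⟨hvJ, hvI⟩ := Submodule.mem_inf.1 hv
    simp only [Submodule.mem_iInf, LinearMap.mem_ker, LinearMap.proj_apply] at hvI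
    refine ⟨v, Submodule.span_mono (Set.image_subset_range c _) hvJ, fun i =>
      ⟨fun hvi => Finset.mem_sdiff.2 ⟨?_, fun hiI => hvi (hvI i hiI)⟩, hvne i⟩⟩
    by_contra hi
    refine hvi ((Submodule.span_le (p := LinearMap.ker
      (LinearMap.proj (R := F) (φ := fun _ : Fin k => F) i))).2 ?_ hvJ)
    rintro _ ⟨j, hj, rfl⟩
    by_contra hc
    exact hi (Finset.mem_biUnion.2 ⟨j, hj, (hmatch j i).1 hc⟩)
end

section
/- Let G be a bipartite graph between finite sets U and J, and let Ĩ ⊆ U be a nonempty set such that every i ∈ Ĩ has at least 2 neighbors in J and |Γ_J(Ĩ)| ≤ |Ĩ|, where Γ_J(X) denotes the set of vertices of J adjacent to some element of X. Then there exists a nonempty subset I′ ⊆ Ĩ with |Γ_J(I′)| = |I′|, and it can be chosen so that every nonempty proper subset I″ ⊊ I′ satisfies |Γ_J(I″)| > |I″|. -/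
open Finset

/-- The neighborhood `Γ_J(X) ⊆ J` of a set `X` of left vertices in a bipartite graph
    between `U` and `J` with adjacency relation `adj`. -/
def nbhd {U J : Type} [Fintype J] (adj : U → J → Prop) [∀ i j, Decidable (adj i j)]
    (X : Finset U) : Finset J :=
  Finset.univ.filter fun j : J => ∃ i ∈ X, adj i j

theorem nbhd_mono {U J : Type} [Fintype J] (adj : U → J → Prop) [∀ i j, Decidable (adj i j)]
    {X Y : Finset U} (h : X ⊆ Y) : nbhd adj X ⊆ nbhd adj Y :=
  monotone_filter_right univ fun _ _ ⟨i, hi, hij⟩ => ⟨i, h hi, hij⟩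

/-- Hall-type lemma: if `Ĩ` is a nonempty set of left vertices of a bipartite graph,
    each with at least 2 neighbors, and `|Γ_J(Ĩ)| ≤ |Ĩ|`, then there is a nonempty
    `I′ ⊆ Ĩ` with `|Γ_J(I′)| = |I′|` which moreover satisfies `|Γ_J(I″)| > |I″|` for
    every nonempty proper subset `I″ ⊊ I′`. -/
theorem exists_tight_subset
    {U J : Type} [Fintype U] [Fintype J] [DecidableEq U] [DecidableEq J]
    (adj : U → J → Prop) [∀ i j, Decidable (adj i j)]
    (It : Finset U) (hne : It.Nonempty)
    (hdeg : ∀ i ∈ It, 2 ≤ (Finset.univ.filter fun j : J => adj i j).card)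
    (hIt : (nbhd adj It).card ≤ It.card) :
    ∃ I' ⊆ It, I'.Nonempty ∧
      (nbhd adj I').card = I'.card ∧
      ∀ I'' ⊂ I', I''.Nonempty → I''.card < (nbhd adj I'').card := by
  obtain ⟨I, hsub, hmin⟩ := exists_minimal_le_of_wellFoundedLT
    (fun X : Finset U => X.Nonempty ∧ (nbhd adj X).card ≤ X.card) It ⟨hne, hIt⟩
  obtain ⟨hI, hcard⟩ := hmin.prop
  have hlt : ∀ X ⊂ I, X.Nonempty → X.card < (nbhd adj X).card := fun X hX hXne =>
    not_le.mp fun h => hmin.not_prop_of_lt hX ⟨hXne, h⟩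
  refine ⟨I, hsub, hI, le_antisymm hcard ?_, hlt⟩
  obtain ⟨i, hi⟩ := hI
  rcases (I.erase i).eq_empty_or_nonempty with h | h
  · have hone : I.card = 1 := by
      rw [← card_erase_add_one hi, h, card_empty]
    have hle : (univ.filter fun j : J => adj i j) ⊆ nbhd adj I :=
      monotone_filter_right univ fun _ _ hj => ⟨i, hi, hj⟩
    have htwo := (hdeg i (hsub hi)).trans (card_le_card hle)
    omega
  · have hss := erase_ssubset hi
    have hcard_lt := hlt _ hss h
    have hle := card_le_card (nbhd_mono adj hss.subset)
    have := card_erase_add_one hi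
    omega
end
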